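/- arXiv:0801.4717 — 2 statements merged into one kernel-verified Lean document; each statement's English description precedes it below -/
import Mathlib

section
/- Consider the RFDE system (4.3) under hypotheses (Q1)-(Q5). Suppose there exist functions a₁, a₂ ∈ K∞, β, μ ∈ K⁺, q ∈ ℰ, a continuous positive definite ρ : [0,∞) → [0,∞), and a functional V : [0,∞)×C⁰([−r,0];ℝⁿ) → [0,∞) which is almost Lipschitz on bounded sets, such that for all (t,x,d) ∈ [0,∞)×C⁰([−r,0];ℝⁿ)×D: max{ a₁(‖H(t,x)‖_𝒴), a₁(μ(t)‖x‖_r) } ≤ V(t,x) ≤ a₂(β(t)‖x‖_r) and V⁰(t, x; f(t,d,x)) ≤ −ρ(V(t,x)) + q(t). Then system (4.3) is RGAOS. Moreover, if β ≡ 1 and q ≡ 0, then system (4.3) is URGAOS. -/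
open Filter Topology MeasureTheory Set RealInnerProductSpace

noncomputable section

/-- ℝⁿ with the Euclidean norm. -/
abbrev Euc (n : ℕ) := EuclideanSpace ℝ (Fin n)

/-- The state space C⁰([−r,0];ℝⁿ) with the sup norm. -/
abbrev Hist (n : ℕ) (r : ℝ) := C(Icc (-r) (0:ℝ), Euc n)

/-- Class K∞ functions (on [0,∞)). -/
def IsKinf (a : ℝ → ℝ) : Prop :=
  ContinuousOn a (Ici 0) ∧ StrictMonoOn a (Ici 0) ∧ a 0 = 0 ∧ Tendsto a atTop atTop

/-- Class K⁺: positive continuous functions on [0,∞). -/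
def IsKplus (b : ℝ → ℝ) : Prop := ContinuousOn b (Ici 0) ∧ ∀ t, 0 ≤ t → 0 < b t

/-- Class ℰ: continuous nonnegative integrable functions on [0,∞) tending to 0. -/
def IsClassE (q : ℝ → ℝ) : Prop :=
  ContinuousOn q (Ici 0) ∧ (∀ t, 0 ≤ t → 0 ≤ q t) ∧
    IntegrableOn q (Ici 0) ∧ Tendsto q atTop (𝓝 0)

/-- Continuous positive definite functions on [0,∞). -/
def IsPosDef (ρ : ℝ → ℝ) : Prop :=
  ContinuousOn ρ (Ici 0) ∧ ρ 0 = 0 ∧ (∀ s, 0 < s → 0 < ρ s) ∧ ∀ s, 0 ≤ s → 0 ≤ ρ s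

/-- Membership in M_D : measurable selections of values in D. -/
def InMD {l : ℕ} (D : Set (Euc l)) (d : ℝ → Euc l) : Prop :=
  Measurable d ∧ ∀ t, d t ∈ D

/-- The operator E_h(x;v) of Section 4.II: E_h(x;v)(θ) = x(0)+(θ+h)v for −h < θ ≤ 0 and
E_h(x;v)(θ) = x(θ+h) for −r ≤ θ ≤ −h. -/
def Ehist {n : ℕ} {r : ℝ} (h : ℝ) (x : Hist n r) (v : Euc n) : Hist n r :=
  if hr : -r ≤ 0 then
    { toFun := fun θ => if (θ : ℝ) ≤ -h then x (projIcc (-r) 0 hr ((θ : ℝ) + h))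
        else x (projIcc (-r) 0 hr 0) + ((θ : ℝ) + h) • v
      continuous_toFun := by
        apply Continuous.if_le
        · exact x.continuous.comp (continuous_projIcc.comp (by fun_prop))
        · exact continuous_const.add ((continuous_subtype_val.add continuous_const).smul
            continuous_const)
        · exact continuous_subtype_val
        · exact continuous_const
        · intro θ hθ
          rw [hθ]
          simp }
  else x

/-- The Dini derivative V⁰(t,x;v) of a functional V : [0,∞)×C⁰([−r,0];ℝⁿ) → ℝ:
V⁰(t,x;v) := limsup_{h→0⁺, y→0} (V(t+h, E_h(x;v)+h·y) − V(t,x))/h. -/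
def diniH {n : ℕ} {r : ℝ} (V : ℝ → Hist n r → ℝ) (t : ℝ) (x : Hist n r) (v : Euc n) :
    EReal :=
  Filter.limsup
    (fun p : ℝ × Hist n r =>
      (((V (t + p.1) (Ehist p.1 x v + p.1 • p.2) - V t x) / p.1 : ℝ) : EReal))
    ((𝓝[>] (0:ℝ)) ×ˢ 𝓝 0)

/-- The simplified Dini derivative V⁰(x;v) := limsup_{h→0⁺} (V(E_h(x;v)) − V(x))/h of a
time-independent functional. -/
def diniH0 {n : ℕ} {r : ℝ} (V : Hist n r → ℝ) (x : Hist n r) (v : Euc n) : EReal :=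
  Filter.limsup (fun h : ℝ => (((V (Ehist h x v) - V x) / h : ℝ) : EReal)) (𝓝[>] (0:ℝ))

/-- x : [t₀−r, tmax) → ℝⁿ (with history map φ) is a solution of the RFDE
ẋ(t) = F(t,d(t),T_r(t)x) with initial condition T_r(t₀)x = x₀, in integral form. -/
def IsSolutionRFDE {n l : ℕ} {r : ℝ} (F : ℝ → Euc l → Hist n r → Euc n)
    (d : ℝ → Euc l) (t₀ : ℝ) (x₀ : Hist n r) (tmax : EReal) (x : ℝ → Euc n)
    (φ : ℝ → Hist n r) : Prop :=
  (t₀ : EReal) < tmax ∧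
  φ t₀ = x₀ ∧
  (∀ t : ℝ, t₀ ≤ t → (t : EReal) < tmax → ∀ θ : Icc (-r) (0:ℝ), φ t θ = x (t + θ)) ∧
  ContinuousOn x {s : ℝ | t₀ - r ≤ s ∧ (s : EReal) < tmax} ∧
  (∀ t : ℝ, t₀ ≤ t → (t : EReal) < tmax → x t = x t₀ + ∫ s in t₀..t, F s (d s) (φ s))

/-- A functional V : [0,∞)×C⁰([−r,0];ℝⁿ) → [0,∞) which is
"almost Lipschitz on bounded sets" (Definition 4.5). -/
def AlmostLipschitzOn {n : ℕ} (r : ℝ) (V : ℝ → Hist n r → ℝ) : Prop :=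
  ContinuousOn (fun p : ℝ × Hist n r => V p.1 p.2) (Ici 0 ×ˢ univ) ∧
  ∃ LV P G : ℝ → ℝ, Monotone LV ∧ Monotone P ∧ Monotone G ∧ (∀ s, 1 ≤ G s) ∧
    (∀ R, 0 ≤ R → ∀ t ∈ Icc (0:ℝ) R, ∀ x y : Hist n r, ‖x‖ ≤ R → ‖y‖ ≤ R →
      |V t y - V t x| ≤ LV R * ‖y - x‖) ∧
    (∀ R, 0 ≤ R → ∀ M : ℝ, 0 ≤ M → ∀ x : Hist n r, ‖x‖ ≤ R →
      LipschitzWith (Real.toNNReal M) (fun θ : Icc (-r) (0:ℝ) => x θ) →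
      ∀ t ∈ Icc (0:ℝ) R, ∀ h : ℝ, 0 ≤ h → h ≤ 1 / G (R + M) →
        |V (t + h) x - V t x| ≤ h * P R * (1 + M))

/-- RGAOS (Definition 4.2) of the system ẋ(t) = F(t,d(t),T_r(t)x), Y(t) = H(t,T_r(t)x),
phrased via the existence of a family of unique maximal solutions satisfying robust
forward completeness and properties P1, P2. -/
def RGAOSrfde {n l : ℕ} {Y : Type*} [NormedAddCommGroup Y] [NormedSpace ℝ Y] (r : ℝ)
    (D : Set (Euc l)) (F : ℝ → Euc l → Hist n r → Euc n) (H : ℝ → Hist n r → Y) : Prop :=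
  ∃ (X : ℝ → Hist n r → (ℝ → Euc l) → ℝ → Euc n)
    (Φ : ℝ → Hist n r → (ℝ → Euc l) → ℝ → Hist n r)
    (tmax : ℝ → Hist n r → (ℝ → Euc l) → EReal),
    (∀ t₀ : ℝ, 0 ≤ t₀ → ∀ x₀ d, InMD D d →
      IsSolutionRFDE F d t₀ x₀ (tmax t₀ x₀ d) (X t₀ x₀ d) (Φ t₀ x₀ d) ∧
      ∀ tm y ψ, IsSolutionRFDE F d t₀ x₀ tm y ψ → tm ≤ tmax t₀ x₀ d ∧
        ∀ t : ℝ, t₀ ≤ t → (t : EReal) < tm → ψ t = Φ t₀ x₀ d t) ∧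
    -- robust forward completeness
    (∀ T, 0 ≤ T → ∀ s, 0 ≤ s → ∃ M, ∀ t₀ ∈ Icc (0:ℝ) T, ∀ ξ ∈ Icc (0:ℝ) T,
      ∀ x₀ : Hist n r, ‖x₀‖ ≤ s → ∀ d, InMD D d →
        ((t₀ + ξ : ℝ) : EReal) < tmax t₀ x₀ d ∧ ‖Φ t₀ x₀ d (t₀ + ξ)‖ ≤ M) ∧
    -- P1 (output stability)
    (∀ ε, 0 < ε → ∀ T, 0 ≤ T →
      (∃ M, ∀ t₀ ∈ Icc (0:ℝ) T, ∀ x₀ : Hist n r, ‖x₀‖ ≤ ε → ∀ d, InMD D d →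
        ∀ t : ℝ, t₀ ≤ t → (t : EReal) < tmax t₀ x₀ d → ‖H t (Φ t₀ x₀ d t)‖ ≤ M) ∧
      (∃ δ, 0 < δ ∧ ∀ t₀ ∈ Icc (0:ℝ) T, ∀ x₀ : Hist n r, ‖x₀‖ ≤ δ → ∀ d, InMD D d →
        ∀ t : ℝ, t₀ ≤ t → (t : EReal) < tmax t₀ x₀ d → ‖H t (Φ t₀ x₀ d t)‖ ≤ ε)) ∧
    -- P2 (uniform output attractivity on bounded sets of initial data)
    (∀ ε, 0 < ε → ∀ T, 0 ≤ T → ∀ R, 0 ≤ R → ∃ τ, 0 ≤ τ ∧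
      ∀ t₀ ∈ Icc (0:ℝ) T, ∀ x₀ : Hist n r, ‖x₀‖ ≤ R → ∀ d, InMD D d →
        ∀ t : ℝ, t₀ + τ ≤ t → (t : EReal) < tmax t₀ x₀ d → ‖H t (Φ t₀ x₀ d t)‖ ≤ ε)

/-- URGAOS (Definition 4.3) of the system ẋ(t) = F(t,d(t),T_r(t)x), Y(t) = H(t,T_r(t)x). -/
def URGAOSrfde {n l : ℕ} {Y : Type*} [NormedAddCommGroup Y] [NormedSpace ℝ Y] (r : ℝ)
    (D : Set (Euc l)) (F : ℝ → Euc l → Hist n r → Euc n) (H : ℝ → Hist n r → Y) : Prop :=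
  ∃ (X : ℝ → Hist n r → (ℝ → Euc l) → ℝ → Euc n)
    (Φ : ℝ → Hist n r → (ℝ → Euc l) → ℝ → Hist n r)
    (tmax : ℝ → Hist n r → (ℝ → Euc l) → EReal),
    (∀ t₀ : ℝ, 0 ≤ t₀ → ∀ x₀ d, InMD D d →
      IsSolutionRFDE F d t₀ x₀ (tmax t₀ x₀ d) (X t₀ x₀ d) (Φ t₀ x₀ d) ∧
      ∀ tm y ψ, IsSolutionRFDE F d t₀ x₀ tm y ψ → tm ≤ tmax t₀ x₀ d ∧
        ∀ t : ℝ, t₀ ≤ t → (t : EReal) < tm → ψ t = Φ t₀ x₀ d t) ∧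
    (∀ T, 0 ≤ T → ∀ s, 0 ≤ s → ∃ M, ∀ t₀ ∈ Icc (0:ℝ) T, ∀ ξ ∈ Icc (0:ℝ) T,
      ∀ x₀ : Hist n r, ‖x₀‖ ≤ s → ∀ d, InMD D d →
        ((t₀ + ξ : ℝ) : EReal) < tmax t₀ x₀ d ∧ ‖Φ t₀ x₀ d (t₀ + ξ)‖ ≤ M) ∧
    (∀ ε, 0 < ε →
      (∃ M, ∀ t₀ : ℝ, 0 ≤ t₀ → ∀ x₀ : Hist n r, ‖x₀‖ ≤ ε → ∀ d, InMD D d →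
        ∀ t : ℝ, t₀ ≤ t → (t : EReal) < tmax t₀ x₀ d → ‖H t (Φ t₀ x₀ d t)‖ ≤ M) ∧
      (∃ δ, 0 < δ ∧ ∀ t₀ : ℝ, 0 ≤ t₀ → ∀ x₀ : Hist n r, ‖x₀‖ ≤ δ → ∀ d, InMD D d →
        ∀ t : ℝ, t₀ ≤ t → (t : EReal) < tmax t₀ x₀ d → ‖H t (Φ t₀ x₀ d t)‖ ≤ ε)) ∧
    (∀ ε, 0 < ε → ∀ R, 0 ≤ R → ∃ τ, 0 ≤ τ ∧
      ∀ t₀ : ℝ, 0 ≤ t₀ → ∀ x₀ : Hist n r, ‖x₀‖ ≤ R → ∀ d, InMD D d →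
        ∀ t : ℝ, t₀ + τ ≤ t → (t : EReal) < tmax t₀ x₀ d → ‖H t (Φ t₀ x₀ d t)‖ ≤ ε)

/-- The window (history segment) of a globally continuous function. -/
def win {n : ℕ} (r : ℝ) (x : C(ℝ, Euc n)) (t : ℝ) : Hist n r :=
  ⟨fun θ => x (t + θ), by fun_prop⟩

lemma win_apply {n : ℕ} (r : ℝ) (x : C(ℝ, Euc n)) (t : ℝ) (θ : Icc (-r) (0:ℝ)) :
    win r x t θ = x (t + θ) := rfl

lemma continuous_win {n : ℕ} (r : ℝ) (x : C(ℝ, Euc n)) : Continuous (win r x) := by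
  let F : C(ℝ × Icc (-r) (0:ℝ), Euc n) := ⟨fun p => x (p.1 + p.2), by fun_prop⟩
  exact F.curry.continuous

lemma norm_le_win {n : ℕ} {r : ℝ} (x : C(ℝ, Euc n)) {t s : ℝ} (h1 : t - r ≤ s) (h2 : s ≤ t) :
    ‖x s‖ ≤ ‖win r x t‖ := by
  have := (win r x t).norm_coe_le_norm ⟨s - t, by constructor <;> linarith⟩
  simpa [win_apply] using this

lemma win_norm_le {n : ℕ} {r : ℝ} (x : C(ℝ, Euc n)) {t C : ℝ} (hC : 0 ≤ C)
    (h : ∀ s, t - r ≤ s → s ≤ t → ‖x s‖ ≤ C) : ‖win r x t‖ ≤ C := by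
  rw [ContinuousMap.norm_le _ hC]
  intro θ
  exact h _ (by linarith [θ.2.1]) (by linarith [θ.2.2])

lemma win_sub {n : ℕ} {r : ℝ} (x y : C(ℝ, Euc n)) (t : ℝ) :
    win r (x - y) t = win r x t - win r y t := by
  ext θ; simp [win_apply]

lemma ftc_le {w g : ℝ → ℝ} {a b : ℝ} (hab : a ≤ b) {K : NNReal}
    (hw : LipschitzOnWith K w (Icc a b)) (hg : IntervalIntegrable g volume a b)
    (h : ∀ᵐ t, t ∈ Icc a b → ∀ w', HasDerivAt w w' t → w' ≤ g t) :
    w b - w a ≤ ∫ t in a..b, g t := by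
  have hac : AbsolutelyContinuousOnInterval w a b :=
    LipschitzOnWith.absolutelyContinuousOnInterval (K := K) (by rwa [uIcc_of_le hab])
  rw [← hac.integral_deriv_eq_sub]
  apply intervalIntegral.integral_mono_ae_restrict hab hac.intervalIntegrable_deriv hg
  refine (ae_restrict_iff' measurableSet_Icc).2 ?_
  filter_upwards [h, hac.ae_differentiableAt] with t ht ht2 hm
  exact ht hm _ (ht2 (by rwa [uIcc_of_le hab])).hasDerivAt

lemma ae_hasDerivAt_of_integral {n : ℕ} {u g : ℝ → Euc n} {a b : ℝ} (hab : a ≤ b)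
    (hg : IntervalIntegrable g volume a b)
    (hu : ∀ t ∈ Icc a b, u t = u a + ∫ s in a..t, g s) :
    ∀ᵐ t, t ∈ Icc a b → (t ∈ Ioo a b ∧ HasDerivAt u (g t) t) := by
  have h₁ : ∀ᵐ x : ℝ, x ≠ a := by simp [ae_iff, measure_singleton]
  have h₂ : ∀ᵐ x : ℝ, x ≠ b := by simp [ae_iff, measure_singleton]
  filter_upwards [hg.ae_hasDerivAt_integral, h₁, h₂] with t ht h1 h2 hm
  have hm' : t ∈ Ioo a b := ⟨lt_of_le_of_ne hm.1 (Ne.symm h1), lt_of_le_of_ne hm.2 h2⟩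
  refine ⟨hm', ?_⟩
  rw [uIcc_of_le hab] at ht
  have := (ht hm a ⟨le_rfl, hab⟩).const_add (u a)
  refine this.congr_of_eventuallyEq ?_
  filter_upwards [Icc_mem_nhds hm'.1 hm'.2] with s hs using hu s hs

lemma lip_of_integral {n : ℕ} {u g : ℝ → Euc n} {a b C : ℝ} 
    (hg : IntervalIntegrable g volume a b) (hC : 0 ≤ C) (hgC : ∀ s ∈ Icc a b, ‖g s‖ ≤ C)
    (hu : ∀ t ∈ Icc a b, u t = u a + ∫ s in a..t, g s) :
    LipschitzOnWith C.toNNReal u (Icc a b) := by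
  have key : ∀ s ∈ Icc a b, ∀ t ∈ Icc a b, s ≤ t → ‖u t - u s‖ ≤ C * (t - s) := by
    intro s hs t ht hst
    have e : u t - u s = ∫ τ in s..t, g τ := by
      rw [hu t ht, hu s hs, add_sub_add_left_eq_sub, intervalIntegral.integral_interval_sub_left]
      · exact hg.mono_set (by rw [uIcc_of_le ht.1, uIcc_of_le (ht.1.trans ht.2)]; exact Icc_subset_Icc le_rfl ht.2)
      · exact hg.mono_set (by rw [uIcc_of_le hs.1, uIcc_of_le (ht.1.trans ht.2)]; exact Icc_subset_Icc le_rfl hs.2)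
    rw [e]
    have := intervalIntegral.norm_integral_le_of_norm_le_const (a := s) (b := t) (f := g) (C := C)
      (fun x hx => by
        rw [uIoc_of_le hst] at hx
        exact hgC x ⟨hs.1.trans hx.1.le, hx.2.trans ht.2⟩)
    rwa [abs_of_nonneg (by linarith)] at this
  refine LipschitzOnWith.of_dist_le_mul ?_
  intro s hs t ht
  rw [Real.coe_toNNReal _ hC, dist_eq_norm, Real.dist_eq]
  rcases le_total s t with h | h
  · rw [norm_sub_rev, abs_sub_comm, abs_of_nonneg (by linarith)]; exact key s hs t ht h
  · rw [abs_of_nonneg (by linarith)]; exact key t ht s hs h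

lemma gronwall_aux {N : ℝ → ℝ} (hN : Continuous N) {a b A L : ℝ} (hab : a ≤ b) (hL : 0 ≤ L)
    (h : ∀ t ∈ Icc a b, N t ≤ A + L * ∫ s in a..t, N s) :
    ∀ t ∈ Icc a b, N t ≤ A * Real.exp (L * (t - a)) := by
  have hd : ∀ t, HasDerivAt (fun t => (A + L * ∫ s in a..t, N s) * Real.exp (-(L * (t - a))))
      ((L * N t) * Real.exp (-(L * (t - a))) + (A + L * ∫ s in a..t, N s) *
        (Real.exp (-(L * (t - a))) * (-(L * 1)))) t := by
    intro t
    have h1 : HasDerivAt (fun t => ∫ s in a..t, N s) (N t) t :=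
      intervalIntegral.integral_hasDerivAt_right (hN.intervalIntegrable _ _)
        (hN.stronglyMeasurableAtFilter _ _) hN.continuousAt
    exact ((h1.const_mul L).const_add A).mul
      ((((hasDerivAt_id t).sub_const a).const_mul L).neg.exp)
  have hanti : AntitoneOn (fun t => (A + L * ∫ s in a..t, N s) * Real.exp (-(L * (t - a))))
      (Icc a b) := by
    apply antitoneOn_of_deriv_nonpos (convex_Icc a b)
    · exact fun t _ => (hd t).continuousAt.continuousWithinAt
    · exact fun t _ => (hd t).differentiableAt.differentiableWithinAt
    · intro t ht
      rw [interior_Icc] at ht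
      rw [(hd t).deriv]
      have := h t ⟨ht.1.le, ht.2.le⟩
      have e := Real.exp_pos (-(L * (t - a)))
      have : L * N t ≤ L * (A + L * ∫ s in a..t, N s) := mul_le_mul_of_nonneg_left this hL
      nlinarith
  intro t ht
  have h1 := hanti ⟨le_rfl, hab⟩ ht ht.1
  simp only [intervalIntegral.integral_same, sub_self, mul_zero, add_zero, neg_zero,
    Real.exp_zero, mul_one] at h1
  have e := Real.exp_pos (L * (t - a))
  have e2 : Real.exp (-(L * (t - a))) * Real.exp (L * (t - a)) = 1 := by
    rw [← Real.exp_add]; simp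
  calc N t ≤ A + L * ∫ s in a..t, N s := h t ht
    _ = ((A + L * ∫ s in a..t, N s) * Real.exp (-(L * (t - a)))) * Real.exp (L * (t - a)) := by
        rw [mul_assoc, e2, mul_one]
    _ ≤ _ := mul_le_mul_of_nonneg_right h1 e.le

lemma gronwall_win {n : ℕ} {r : ℝ} (hr : 0 < r) (u : C(ℝ, Euc n)) (g : ℝ → Euc n)
    {a b C L η : ℝ} (hab : a ≤ b) (hC : 0 ≤ C) (hL : 0 ≤ L) (hη : 0 ≤ η)
    (hg : IntervalIntegrable g volume a b) (hgC : ∀ s ∈ Icc a b, ‖g s‖ ≤ C)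
    (hu : ∀ t ∈ Icc a b, u t = u a + ∫ s in a..t, g s)
    (h : ∀ s ∈ Icc a b, ⟪u s, g s⟫ ≤ L * ‖win r u s‖ ^ 2 + η) :
    ∀ t ∈ Icc a b, ‖win r u t‖ ^ 2 ≤
      (‖win r u a‖ ^ 2 + 2 * η * (b - a)) * Real.exp (2 * L * (b - a)) := by
  set N : ℝ → ℝ := fun s => ‖win r u s‖ ^ 2 with hNdef
  have hN : Continuous N := (continuous_win r u).norm.pow 2
  have hN0 : ∀ s, 0 ≤ N s := fun s => by positivity
  have hlip := lip_of_integral hg hC hgC hu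
  obtain ⟨B, hB⟩ := (isCompact_Icc (a := a) (b := b)).exists_bound_of_continuousOn
    (f := u) u.continuous.continuousOn
  have step1 : ∀ t ∈ Icc a b, ‖u t‖ ^ 2 - ‖u a‖ ^ 2 ≤ ∫ s in a..t, (2 * (L * N s + η)) := by
    intro t ht
    have hsub : Icc a t ⊆ Icc a b := Icc_subset_Icc le_rfl ht.2
    have hB0 : 0 ≤ B := (norm_nonneg _).trans (hB a ⟨le_rfl, hab⟩)
    refine ftc_le (w := fun t => ‖u t‖ ^ 2) ht.1 (K := (2 * B * C).toNNReal) ?_ ?_ ?_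
    · refine LipschitzOnWith.of_dist_le_mul ?_
      intro s hs τ hτ
      have h1 := hlip.dist_le_mul s (hsub hs) τ (hsub hτ)
      rw [Real.coe_toNNReal _ hC, dist_eq_norm] at h1
      rw [Real.coe_toNNReal _ (by positivity), Real.dist_eq]
      have h2 := abs_norm_sub_norm_le (u s) (u τ)
      have h3 := hB s (hsub hs)
      have h4 := hB τ (hsub hτ)
      have e : ‖u s‖ ^ 2 - ‖u τ‖ ^ 2 = (‖u s‖ + ‖u τ‖) * (‖u s‖ - ‖u τ‖) := by ring
      rw [e, abs_mul, abs_of_nonneg (by positivity), mul_assoc (2 * B)]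
      exact mul_le_mul (by linarith) (h2.trans h1) (abs_nonneg _) (by positivity)
    · exact Continuous.intervalIntegrable (by fun_prop) _ _
    · filter_upwards [ae_hasDerivAt_of_integral hab hg hu] with s hs hm w' hw'
      have h1 := (hs (hsub hm)).2.norm_sq
      rw [hw'.unique h1]
      have := h s (hsub hm)
      simp only [hNdef]; linarith
  have step2 : ∀ t ∈ Icc a b, ‖u t‖ ^ 2 ≤ ‖u a‖ ^ 2 + 2 * η * (b - a) + 2 * L * ∫ s in a..t, N s := by
    intro t ht
    have h1 := step1 t ht
    rw [intervalIntegral.integral_const_mul, intervalIntegral.integral_add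
      ((hN.const_mul L).intervalIntegrable _ _) (by simp), intervalIntegral.integral_const_mul] at h1
    simp only [intervalIntegral.integral_const, smul_eq_mul] at h1
    have : η * (t - a) ≤ η * (b - a) := mul_le_mul_of_nonneg_left (by linarith [ht.2]) hη
    nlinarith
  have hmono : ∀ s t, a ≤ s → s ≤ t → ∫ τ in a..s, N τ ≤ ∫ τ in a..t, N τ := by
    intro s t h1 h2
    exact intervalIntegral.integral_mono_interval le_rfl h1 h2 (Eventually.of_forall hN0)
      (hN.intervalIntegrable _ _)
  have hA0 : 0 ≤ N a + 2 * η * (b - a) := by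
    have : 0 ≤ b - a := by linarith
    have := hN0 a
    positivity
  have step3 : ∀ t ∈ Icc a b, N t ≤ (N a + 2 * η * (b - a)) + 2 * L * ∫ s in a..t, N s := by
    intro t ht
    have hI : 0 ≤ ∫ s in a..t, N s := intervalIntegral.integral_nonneg ht.1 (fun s _ => hN0 s)
    have hR : 0 ≤ (N a + 2 * η * (b - a)) + 2 * L * ∫ s in a..t, N s := by positivity
    have : ‖win r u t‖ ≤ √((N a + 2 * η * (b - a)) + 2 * L * ∫ s in a..t, N s) := by
      apply win_norm_le _ (Real.sqrt_nonneg _)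
      intro s h1 h2
      apply Real.le_sqrt_of_sq_le
      rcases le_total s a with h3 | h3
      · have := norm_le_win (r := r) u (t := a) (s := s) (by linarith [ht.1]) h3
        have : ‖u s‖ ^ 2 ≤ N a := by simp only [hNdef]; gcongr
        have : 0 ≤ 2 * η * (b - a) := by
          have : 0 ≤ b - a := by linarith
          positivity
        have : 0 ≤ 2 * L * ∫ s in a..t, N s := by positivity
        linarith
      · have h4 := step2 s ⟨h3, h2.trans ht.2⟩
        have h5 := hmono s t h3 h2
        have h6 := norm_le_win (r := r) u (t := a) (s := a) (by linarith) le_rfl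
        have h7 : ‖u a‖ ^ 2 ≤ N a := by simp only [hNdef]; gcongr
        have := mul_le_mul_of_nonneg_left h5 (by positivity : 0 ≤ 2 * L)
        linarith
    have h8 := pow_le_pow_left₀ (norm_nonneg _) this 2
    rwa [Real.sq_sqrt hR] at h8
  intro t ht
  refine (gronwall_aux hN hab (by positivity) step3 t ht).trans ?_
  apply mul_le_mul_of_nonneg_left _ hA0
  apply Real.exp_le_exp.2
  apply mul_le_mul_of_nonneg_left (by linarith [ht.2]) (by positivity)

/-- Regularity of a right-hand side: measurability along continuous curves and continuity. -/
structure RegF {n l : ℕ} {r : ℝ} (D : Set (Euc l)) (F : ℝ → Euc l → Hist n r → Euc n) : Prop where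
  meas : ∀ d, InMD D d → ∀ φ : ℝ → Hist n r, Continuous φ →
    AEStronglyMeasurable (fun s => F s (d s) (φ s)) (volume.restrict (Ici 0))
  cont : ∀ s, 0 ≤ s → ∀ δ ∈ D, Continuous (F s δ)

lemma RegF.intble {n l : ℕ} {r : ℝ} {D : Set (Euc l)} {F : ℝ → Euc l → Hist n r → Euc n}
    (hF : RegF D F) {d : ℝ → Euc l} (hd : InMD D d) {φ : ℝ → Hist n r} (hφ : Continuous φ)
    {a b M : ℝ} (ha : 0 ≤ a) (hab : a ≤ b) (hM : ∀ s ∈ Icc a b, ‖F s (d s) (φ s)‖ ≤ M) :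
    IntervalIntegrable (fun s => F s (d s) (φ s)) volume a b := by
  rw [intervalIntegrable_iff_integrableOn_Icc_of_le hab]
  have hm : AEStronglyMeasurable (fun s => F s (d s) (φ s)) (volume.restrict (Icc a b)) :=
    (hF.meas d hd φ hφ).mono_measure (Measure.restrict_mono (fun s hs => ha.trans hs.1) le_rfl)
  refine ⟨hm, HasFiniteIntegral.of_bounded (C := M) ?_⟩
  · exact (ae_restrict_iff' measurableSet_Icc).2 (Eventually.of_forall hM)

lemma exists_unif_limit {n : ℕ} (x : ℕ → C(ℝ, Euc n)) (b : ℕ → ℝ) (hb : Tendsto b atTop (𝓝 0))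
    (h : ∀ N k, N ≤ k → ∀ t, ‖x N t - x k t‖ ≤ b N) :
    ∃ y : C(ℝ, Euc n), ∀ N t, ‖x N t - y t‖ ≤ b N := by
  have hc : ∀ t, ∃ y, Tendsto (fun k => x k t) atTop (𝓝 y) := by
    intro t
    apply cauchySeq_tendsto_of_complete
    apply cauchySeq_of_le_tendsto_0' b _ hb
    intro N k hNk
    rw [dist_eq_norm]; exact h N k hNk t
  choose y hy using hc
  have hle : ∀ N t, ‖x N t - y t‖ ≤ b N := by
    intro N t
    apply le_of_tendsto ((tendsto_const_nhds.sub (hy t)).norm)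
    filter_upwards [eventually_ge_atTop N] with k hk using h N k hk t
  have hcont : Continuous y := by
    have : TendstoUniformly (fun k t => x k t) y atTop := by
      rw [Metric.tendstoUniformly_iff]
      intro ε hε
      filter_upwards [hb.eventually (gt_mem_nhds hε)] with k hk t
      rw [dist_comm, dist_eq_norm]
      exact (hle k t).trans_lt hk
    exact this.continuous (Frequently.of_forall fun k => (x k).continuous)
  exact ⟨⟨y, hcont⟩, hle⟩

lemma limit_sol {n l : ℕ} {r : ℝ} {D : Set (Euc l)} {F : ℝ → Euc l → Hist n r → Euc n}
    (hF : RegF D F) {d : ℝ → Euc l} (hd : InMD D d) {a b M : ℝ} (ha : 0 ≤ a)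
    (xk : ℕ → C(ℝ, Euc n)) (x : C(ℝ, Euc n)) (z : ℕ → ℝ → Hist n r) (hzc : ∀ k, Continuous (z k))
    (hx : ∀ t, Tendsto (fun k => xk k t) atTop (𝓝 (x t)))
    (hz : ∀ s ∈ Icc a b, Tendsto (fun k => z k s) atTop (𝓝 (win r x s)))
    (hM : ∀ k, ∀ s ∈ Icc a b, ‖F s (d s) (z k s)‖ ≤ M)
    (heq : ∀ k, ∀ t ∈ Icc a b, xk k t = xk k a + ∫ s in a..t, F s (d s) (z k s)) :
    ∀ t ∈ Icc a b, x t = x a + ∫ s in a..t, F s (d s) (win r x s) := by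
  intro t ht
  have h1 : Tendsto (fun k => ∫ s in a..t, F s (d s) (z k s)) atTop
      (𝓝 (∫ s in a..t, F s (d s) (win r x s))) := by
    apply intervalIntegral.tendsto_integral_filter_of_dominated_convergence (fun _ => M)
    · refine Eventually.of_forall fun k => ?_
      refine (hF.meas d hd (z k) (hzc k)).mono_measure (Measure.restrict_mono ?_ le_rfl)
      rw [uIoc_of_le ht.1]
      exact fun s hs => ha.trans hs.1.le
    · refine Eventually.of_forall fun k => Eventually.of_forall fun s hs => ?_
      rw [uIoc_of_le ht.1] at hs
      exact hM k s ⟨hs.1.le, hs.2.trans ht.2⟩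
    · simp
    · refine Eventually.of_forall fun s hs => ?_
      rw [uIoc_of_le ht.1] at hs
      exact ((hF.cont s (ha.trans hs.1.le) _ (hd.2 s)).tendsto _).comp
        (hz s ⟨hs.1.le, hs.2.trans ht.2⟩)
  have h2 := (hx a).add h1
  refine tendsto_nhds_unique (hx t) (h2.congr fun k => (heq k t ht).symm)

lemma win_dist_le {n : ℕ} {r : ℝ} (x y : C(ℝ, Euc n)) {ε : ℝ} (hε : 0 ≤ ε) (t : ℝ)
    (h : ∀ s, ‖x s - y s‖ ≤ ε) : ‖win r x t - win r y t‖ ≤ ε := by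
  rw [← win_sub]
  exact win_norm_le _ hε fun s _ _ => h s

lemma win_shift_le {n : ℕ} {r : ℝ} (x : C(ℝ, Euc n)) {K : NNReal} (hx : LipschitzWith K x)
    (s t : ℝ) : ‖win r x s - win r x t‖ ≤ K * |s - t| := by
  rw [ContinuousMap.norm_le _ (by positivity)]
  intro θ
  have := hx.dist_le_mul (s + θ) (t + θ)
  rw [dist_eq_norm, Real.dist_eq] at this
  simpa [win_apply] using this

lemma tonelli {n l : ℕ} {r : ℝ} (hr : 0 < r) {D : Set (Euc l)}
    {F : ℝ → Euc l → Hist n r → Euc n} (hF : RegF D F) {d : ℝ → Euc l} (hd : InMD D d)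
    {t₀ T M : ℝ} (ht₀ : 0 ≤ t₀) (hT : t₀ ≤ T) (hM0 : 0 ≤ M)
    (hM : ∀ s ∈ Icc t₀ T, ∀ δ ∈ D, ∀ x, ‖F s δ x‖ ≤ M)
    (x₀ : Hist n r) {K : NNReal} (hK : LipschitzWith K x₀) {δ : ℝ} (hδ : 0 < δ) :
    ∃ x : C(ℝ, Euc n), LipschitzWith (K + M.toNNReal) x ∧
      (∀ t, x t = IccExtend (by linarith : -r ≤ 0) x₀ (t - t₀) +
        ∫ s in t₀..(max t₀ (min T t)), F s (d s) (win r x (s - δ))) := by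
  have hp : ∀ t, max t₀ (min T t) ∈ Icc t₀ T := fun t =>
    ⟨le_max_left _ _, max_le hT (min_le_left _ _)⟩
  have hplip : LipschitzWith 1 (fun t : ℝ => max t₀ (min T t)) :=
    (LipschitzWith.id.const_min T).const_max t₀
  have hext : LipschitzWith K (fun t : ℝ => IccExtend (by linarith : -r ≤ 0) x₀ (t - t₀)) := by
    have h1 : LipschitzWith (K * 1) (IccExtend (by linarith : -r ≤ 0) x₀) :=
      hK.comp (LipschitzWith.projIcc _)
    have h2 := h1.comp (LipschitzWith.id.sub (LipschitzWith.const t₀))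
    simp only [mul_one, add_zero] at h2
    exact h2
  have hΓ : ∀ x : C(ℝ, Euc n), ∃ y : C(ℝ, Euc n), LipschitzWith (K + M.toNNReal) y ∧
      (∀ t, y t = IccExtend (by linarith : -r ≤ 0) x₀ (t - t₀) +
        ∫ s in t₀..(max t₀ (min T t)), F s (d s) (win r x (s - δ))) := by
    intro x
    have hcw : Continuous (fun s => win r x (s - δ)) :=
      (continuous_win r x).comp (continuous_id.sub continuous_const)
    have hint := hF.intble hd hcw ht₀ hT (fun s hs => hM s hs _ (hd.2 s) _)
    have hl := lip_of_integral (u := fun t => ∫ s in t₀..t, F s (d s) (win r x (s - δ)))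
      hint hM0 (fun s hs => hM s hs _ (hd.2 s) _) (by simp)
    have hl2 : LipschitzWith M.toNNReal (fun t =>
        ∫ s in t₀..(max t₀ (min T t)), F s (d s) (win r x (s - δ))) := by
      refine LipschitzWith.of_dist_le_mul fun s t => ?_
      refine (hl.dist_le_mul _ (hp s) _ (hp t)).trans ?_
      have := hplip.dist_le_mul s t
      simp only [NNReal.coe_one, one_mul] at this
      gcongr
    have hl3 := hext.add hl2
    exact ⟨⟨_, hl3.continuous⟩, hl3, fun t => rfl⟩
  choose Γ hΓ1 hΓ2 using hΓ
  have claim : ∀ j : ℕ, ∀ t, max t₀ (min T t) ≤ t₀ + j * δ →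
      Γ (Γ^[j + 1] 0) t = Γ^[j + 1] 0 t := by
    intro j
    induction j with
    | zero =>
      intro t ht
      have : max t₀ (min T t) = t₀ := le_antisymm (by simpa using ht) (hp t).1
      simp only [zero_add, Function.iterate_one]
      rw [hΓ2, hΓ2 0, this]
      simp
    | succ j ih =>
      intro t ht
      rw [Function.iterate_succ_apply' Γ (j + 1)]
      rw [hΓ2 _ t, hΓ2 _ t]
      congr 1
      apply intervalIntegral.integral_congr
      intro s hs
      rw [uIcc_of_le (hp t).1] at hs
      simp only
      congr 1
      ext1 θ
      rw [win_apply, win_apply]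
      apply ih
      have h1 : s - δ + θ ≤ t₀ + j * δ := by
        have := θ.2.2
        have := hs.2
        push_cast at ht
        linarith
      apply max_le
      · have : (0:ℝ) ≤ j * δ := by positivity
        linarith
      · exact (min_le_right _ _).trans h1
  obtain ⟨N, hN⟩ := exists_nat_ge ((T - t₀) / δ)
  have hN' : T ≤ t₀ + N * δ := by
    rw [div_le_iff₀ hδ] at hN; linarith
  refine ⟨Γ^[N + 1] 0, ?_, ?_⟩
  · rw [Function.iterate_succ_apply']; exact hΓ1 _
  · intro t
    rw [← hΓ2, claim N t ((hp t).2.trans hN')]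

lemma exists_sol_lip {n l : ℕ} {r : ℝ} (hr : 0 < r) (h0 : (0:ℝ) ∈ Icc (-r) 0) {D : Set (Euc l)}
    {F : ℝ → Euc l → Hist n r → Euc n} (hF : RegF D F) {d : ℝ → Euc l} (hd : InMD D d)
    {t₀ T M L : ℝ} (ht₀ : 0 ≤ t₀) (hT : t₀ ≤ T) (hM0 : 0 ≤ M) (hL : 0 ≤ L)
    (hM : ∀ s ∈ Icc t₀ T, ∀ δ ∈ D, ∀ x, ‖F s δ x‖ ≤ M)
    (hone : ∀ s ∈ Icc t₀ T, ∀ δ ∈ D, ∀ x y : Hist n r,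
      ⟪x ⟨0, h0⟩ - y ⟨0, h0⟩, F s δ x - F s δ y⟫ ≤ L * ‖x - y‖ ^ 2)
    (x₀ : Hist n r) {K : NNReal} (hK : LipschitzWith K x₀) :
    ∃ x : C(ℝ, Euc n), (∃ K', LipschitzWith K' x) ∧ win r x t₀ = x₀ ∧
      ∀ t ∈ Icc t₀ T, x t = x t₀ + ∫ s in t₀..t, F s (d s) (win r x s) := by
  have hδpos : ∀ k : ℕ, (0:ℝ) < 1 / ((k:ℝ) + 1) := fun k => by positivity
  choose X hXlip hX using fun k : ℕ => tonelli hr hF hd ht₀ hT hM0 hM x₀ hK (hδpos k)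
  set K' : NNReal := K + M.toNNReal with hK'
  have hext : ∀ t, t₀ ≤ t → IccExtend (by linarith : -r ≤ 0) x₀ (t - t₀) = x₀ ⟨0, h0⟩ := by
    intro t ht
    rw [IccExtend_of_right_le _ _ (by linarith)]
  have hXt₀ : ∀ k, X k t₀ = x₀ ⟨0, h0⟩ := by
    intro k
    rw [hX k t₀, hext _ le_rfl]
    simp [hT]
  have hXle : ∀ k, ∀ t ≤ t₀, X k t = IccExtend (by linarith : -r ≤ 0) x₀ (t - t₀) := by
    intro k t ht
    rw [hX k t, max_eq_left ((min_le_right _ _).trans ht)]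
    simp
  have hXint : ∀ k, ∀ t ∈ Icc t₀ T, X k t = X k t₀ +
      ∫ s in t₀..t, F s (d s) (win r (X k) (s - 1 / ((k:ℝ) + 1))) := by
    intro k t ht
    rw [hX k t, hext _ ht.1, hXt₀, min_eq_right ht.2, max_eq_right ht.1]
  have hXge : ∀ k, ∀ t, T ≤ t → X k t = X k T := by
    intro k t ht
    rw [hX k t, hX k T, hext _ hT, hext _ (hT.trans ht), min_eq_left ht, min_self]
  have hzc : ∀ k : ℕ, Continuous (fun s => win r (X k) (s - 1 / ((k:ℝ) + 1))) := fun k =>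
    (continuous_win r (X k)).comp (continuous_id.sub continuous_const)
  have hint : ∀ k : ℕ, IntervalIntegrable
      (fun s => F s (d s) (win r (X k) (s - 1 / ((k:ℝ) + 1)))) volume t₀ T := fun k =>
    hF.intble hd (hzc k) ht₀ hT (fun s hs => hM s hs _ (hd.2 s) _)
  set ψ : ℝ → ℝ := fun ε => √((2 * (2 * L * ε ^ 2 + 2 * M * ε) * (T - t₀)) *
    Real.exp (2 * (2 * L) * (T - t₀))) with hψ
  have hcauchy : ∀ N k, N ≤ k → ∀ t, ‖X N t - X k t‖ ≤ ψ (2 * K' * (1 / ((N:ℝ) + 1))) := by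
    intro N k hNk
    set ε : ℝ := 2 * K' * (1 / ((N:ℝ) + 1)) with hε
    have hε0 : 0 ≤ ε := by positivity
    have hkN : 1 / ((k:ℝ) + 1) ≤ 1 / ((N:ℝ) + 1) := by
      apply one_div_le_one_div_of_le (by positivity)
      have : (N:ℝ) ≤ k := by exact_mod_cast hNk
      linarith
    have hsh : ∀ m : ℕ, N ≤ m → ∀ s, ‖win r (X m) (s - 1 / ((m:ℝ) + 1)) - win r (X m) s‖ ≤ ε / 2 := by
      intro m hm s
      have h1 := win_shift_le (r := r) (X m) (hXlip m) (s - 1 / ((m:ℝ) + 1)) s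
      have h2 : |s - 1 / ((m:ℝ) + 1) - s| ≤ 1 / ((N:ℝ) + 1) := by
        rw [sub_sub_cancel_left, abs_neg, abs_of_pos (hδpos m)]
        apply one_div_le_one_div_of_le (by positivity)
        have : (N:ℝ) ≤ m := by exact_mod_cast hm
        linarith
      refine h1.trans ?_
      have := mul_le_mul_of_nonneg_left h2 K'.coe_nonneg
      rw [hε]; linarith
    have hg := gronwall_win (r := r) hr (X N - X k)
      (fun s => F s (d s) (win r (X N) (s - 1 / ((N:ℝ) + 1))) -
        F s (d s) (win r (X k) (s - 1 / ((k:ℝ) + 1)))) (a := t₀) (b := T) (C := 2 * M)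
      (L := 2 * L) (η := 2 * L * ε ^ 2 + 2 * M * ε) hT (by positivity) (by positivity)
      (by positivity) ((hint N).sub (hint k)) ?_ ?_ ?_
    · have hwin0 : win r (X N - X k) t₀ = 0 := by
        ext1 θ
        rw [win_apply, ContinuousMap.sub_apply, hXle N _ (by linarith [θ.2.2]),
          hXle k _ (by linarith [θ.2.2])]
        simp
      rw [hwin0] at hg
      simp only [norm_zero, ne_eq, OfNat.ofNat_ne_zero, not_false_eq_true, zero_pow, zero_add] at hg
      have hmid : ∀ t ∈ Icc t₀ T, ‖X N t - X k t‖ ≤ ψ ε := by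
        intro t ht
        have h1 := norm_le_win (r := r) (X N - X k) (t := t) (s := t) (by linarith) le_rfl
        refine (h1.trans ?_)
        exact Real.le_sqrt_of_sq_le (hg t ht)
      intro t
      rcases le_total t t₀ with h | h
      · rw [hXle N t h, hXle k t h]; rw [sub_self, norm_zero]; exact Real.sqrt_nonneg _
      · rcases le_total t T with h' | h'
        · exact hmid t ⟨h, h'⟩
        · rw [hXge N t h', hXge k t h']; exact hmid T ⟨hT, le_rfl⟩
    · intro s hs
      refine (norm_sub_le _ _).trans ?_
      have h1 := hM s hs _ (hd.2 s) (win r (X N) (s - 1 / ((N:ℝ) + 1)))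
      have h2 := hM s hs _ (hd.2 s) (win r (X k) (s - 1 / ((k:ℝ) + 1)))
      linarith
    · intro t ht
      have hsub : uIcc t₀ t ⊆ uIcc t₀ T := by
        rw [uIcc_of_le ht.1, uIcc_of_le hT]; exact Icc_subset_Icc le_rfl ht.2
      rw [intervalIntegral.integral_sub ((hint N).mono_set hsub) ((hint k).mono_set hsub)]
      simp only [ContinuousMap.sub_apply]
      rw [hXint N t ht, hXint k t ht]
      abel
    · intro s hs
      set zN := win r (X N) (s - 1 / ((N:ℝ) + 1)) with hzN
      set zk := win r (X k) (s - 1 / ((k:ℝ) + 1)) with hzk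
      have h1 := hone s hs _ (hd.2 s) zN zk
      have hA := hsh N le_rfl s
      have hB := hsh k hNk s
      rw [← hzN] at hA
      rw [← hzk] at hB
      have h2 : ‖zN - zk‖ ≤ ‖win r (X N - X k) s‖ + ε := by
        rw [win_sub]
        have : zN - zk = (win r (X N) s - win r (X k) s) + ((zN - win r (X N) s) - (zk - win r (X k) s)) := by abel
        rw [this]
        refine (norm_add_le _ _).trans ?_
        have := norm_sub_le (zN - win r (X N) s) (zk - win r (X k) s)
        linarith
      have h3 : ‖zN - zk‖ ^ 2 ≤ 2 * ‖win r (X N - X k) s‖ ^ 2 + 2 * ε ^ 2 := by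
        have := pow_le_pow_left₀ (norm_nonneg _) h2 2
        nlinarith [sq_nonneg (‖win r (X N - X k) s‖ - ε)]
      have h4 : ‖(X N - X k) s - (zN ⟨0, h0⟩ - zk ⟨0, h0⟩)‖ ≤ ε := by
        have e : (X N - X k) s - (zN ⟨0, h0⟩ - zk ⟨0, h0⟩) =
          -((zN - win r (X N) s) - (zk - win r (X k) s)) ⟨0, h0⟩ := by
          simp only [ContinuousMap.sub_apply, win_apply, add_zero]; abel
        rw [e, norm_neg]
        refine (ContinuousMap.norm_coe_le_norm _ _).trans ?_
        have := norm_sub_le (zN - win r (X N) s) (zk - win r (X k) s)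
        linarith
      have h5 : ‖F s (d s) zN - F s (d s) zk‖ ≤ 2 * M := by
        refine (norm_sub_le _ _).trans ?_
        have h1 := hM s hs _ (hd.2 s) zN
        have h2 := hM s hs _ (hd.2 s) zk
        linarith
      have h6 : ⟪(X N - X k) s - (zN ⟨0, h0⟩ - zk ⟨0, h0⟩), F s (d s) zN - F s (d s) zk⟫ ≤
          ε * (2 * M) :=
        (real_inner_le_norm _ _).trans (mul_le_mul h4 h5 (norm_nonneg _) hε0)
      rw [inner_sub_left] at h6
      have h7 := mul_le_mul_of_nonneg_left h3 hL
      linarith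
  have hψ0 : Tendsto (fun N : ℕ => ψ (2 * K' * (1 / ((N:ℝ) + 1)))) atTop (𝓝 0) := by
    have h1 : Tendsto (fun N : ℕ => 2 * (K':ℝ) * (1 / ((N:ℝ) + 1))) atTop (𝓝 (2 * K' * 0)) :=
      tendsto_one_div_add_atTop_nhds_zero_nat.const_mul _
    have h2 : Continuous ψ := by fun_prop
    have h3 := (h2.tendsto _).comp h1
    have h4 : ψ (2 * K' * 0) = 0 := by simp [hψ]
    rw [h4] at h3
    exact h3
  obtain ⟨x, hx⟩ := exists_unif_limit X _ hψ0 hcauchy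
  have hxt : ∀ t, Tendsto (fun k => X k t) atTop (𝓝 (x t)) := by
    intro t
    rw [tendsto_iff_norm_sub_tendsto_zero]
    exact squeeze_zero (fun _ => norm_nonneg _) (fun N => hx N t) hψ0
  refine ⟨x, ⟨K', ?_⟩, ?_, ?_⟩
  · refine LipschitzWith.of_dist_le_mul fun s t => ?_
    exact le_of_tendsto ((hxt s).dist (hxt t)) (Eventually.of_forall fun k => (hXlip k).dist_le_mul s t)
  · ext1 θ
    rw [win_apply]
    refine tendsto_nhds_unique (hxt _) ?_
    refine tendsto_const_nhds.congr fun k => ?_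
    rw [hXle k _ (by linarith [θ.2.2])]
    rw [IccExtend_of_mem _ _ (by simp)]
    congr 1
    ext; simp
  · refine limit_sol hF hd ht₀ X x (fun k s => win r (X k) (s - 1 / ((k:ℝ) + 1))) hzc hxt ?_
      (fun k s hs => hM s hs _ (hd.2 s) _) hXint
    intro s hs
    rw [tendsto_iff_norm_sub_tendsto_zero]
    have hb : Tendsto (fun N : ℕ => K' * (1 / ((N:ℝ) + 1)) + ψ (2 * K' * (1 / ((N:ℝ) + 1)))) atTop
        (𝓝 (K' * 0 + 0)) := (tendsto_one_div_add_atTop_nhds_zero_nat.const_mul _).add hψ0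
    rw [mul_zero, add_zero] at hb
    refine squeeze_zero (fun _ => norm_nonneg _) (fun N => ?_) hb
    have h1 := win_shift_le (r := r) (X N) (hXlip N) (s - 1 / ((N:ℝ) + 1)) s
    rw [sub_sub_cancel_left, abs_neg, abs_of_pos (hδpos N)] at h1
    have h2 := win_dist_le (r := r) (X N) x (Real.sqrt_nonneg _) s (hx N)
    exact (norm_sub_le_norm_sub_add_norm_sub _ _ _).trans (add_le_add h1 h2)

lemma regF_of_Q {n l : ℕ} {r : ℝ} {D : Set (Euc l)} (hD : IsCompact D)
    {f : ℝ → Euc l → Hist n r → Euc n}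
    (hQ1a : ∀ t : ℝ, 0 ≤ t →
      ContinuousOn (fun p : Hist n r × Euc l => f t p.2 p.1) (univ ×ˢ D))
    {A : Set ℝ} (hA : A.Countable)
    (hc : ContinuousOn (fun p : ℝ × Hist n r × Euc l => f p.1 p.2.2 p.2.1)
        ((Ici 0 \ A) ×ˢ univ ×ˢ D)) : RegF D f := by
  constructor
  · intro d hd φ hφ
    letI : MeasurableSpace (Hist n r) := borel _
    haveI : BorelSpace (Hist n r) := ⟨rfl⟩
    classical
    have hSm : MeasurableSet (Ici (0:ℝ) \ A) := measurableSet_Ici.diff hA.measurableSet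
    have hKm : MeasurableSet ((Ici (0:ℝ) \ A) ×ˢ (univ : Set (Hist n r)) ×ˢ D) :=
      hSm.prod (MeasurableSet.univ.prod hD.measurableSet)
    have h1 := hc.measurable_piecewise (g := fun _ => (0 : Euc n)) continuousOn_const hKm
    have h2 : Measurable (fun s => (s, φ s, d s)) :=
      measurable_id.prodMk (hφ.measurable.prodMk hd.1)
    have h3 := (h1.comp h2).aestronglyMeasurable (μ := volume.restrict (Ici (0:ℝ)))
    refine h3.congr ?_
    have hA0 : ∀ᵐ s : ℝ, s ∉ A := by
      rw [ae_iff]; simpa using hA.measure_zero volume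
    refine (ae_restrict_iff' measurableSet_Ici).2 ?_
    filter_upwards [hA0] with s hs hs0
    simp only [Function.comp]
    rw [piecewise_eq_of_mem]
    exact ⟨⟨hs0, hs⟩, mem_univ _, hd.2 s⟩
  · intro s hs δ hδ
    exact (hQ1a s hs).comp_continuous (f := fun x => (x, δ)) (by fun_prop) (fun x => ⟨mem_univ _, hδ⟩)

lemma cont_dep {n l : ℕ} {r : ℝ} (hr : 0 < r) (h0 : (0:ℝ) ∈ Icc (-r) 0) {D : Set (Euc l)}
    {F : ℝ → Euc l → Hist n r → Euc n} (hF : RegF D F) {d : ℝ → Euc l} (hd : InMD D d)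
    {a b M L R : ℝ} (ha : 0 ≤ a) (hab : a ≤ b) (hM0 : 0 ≤ M) (hL : 0 ≤ L)
    (hM : ∀ s ∈ Icc a b, ∀ δ ∈ D, ∀ x, ‖x‖ ≤ R → ‖F s δ x‖ ≤ M)
    (hone : ∀ s ∈ Icc a b, ∀ δ ∈ D, ∀ x y : Hist n r, ‖x‖ ≤ R → ‖y‖ ≤ R →
      ⟪x ⟨0, h0⟩ - y ⟨0, h0⟩, F s δ x - F s δ y⟫ ≤ L * ‖x - y‖ ^ 2)
    (x y : C(ℝ, Euc n)) (hxR : ∀ s ∈ Icc a b, ‖win r x s‖ ≤ R)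
    (hyR : ∀ s ∈ Icc a b, ‖win r y s‖ ≤ R)
    (hx : ∀ t ∈ Icc a b, x t = x a + ∫ s in a..t, F s (d s) (win r x s))
    (hy : ∀ t ∈ Icc a b, y t = y a + ∫ s in a..t, F s (d s) (win r y s)) :
    ∀ t ∈ Icc a b, ‖win r x t - win r y t‖ ≤ ‖win r x a - win r y a‖ * Real.exp (L * (b - a)) := by
  have hix := hF.intble hd (continuous_win r x) ha hab
    (fun s hs => hM s hs _ (hd.2 s) _ (hxR s hs))
  have hiy := hF.intble hd (continuous_win r y) ha hab
    (fun s hs => hM s hs _ (hd.2 s) _ (hyR s hs))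
  have hg := gronwall_win (r := r) hr (x - y)
      (fun s => F s (d s) (win r x s) - F s (d s) (win r y s)) (C := 2 * M)
      (L := L) (η := 0) hab (by positivity) hL le_rfl (hix.sub hiy) ?_ ?_ ?_
  · intro t ht
    have h1 := hg t ht
    rw [win_sub, win_sub] at h1
    have e : (‖win r x a - win r y a‖ ^ 2 + 2 * 0 * (b - a)) * Real.exp (2 * L * (b - a)) =
        (‖win r x a - win r y a‖ * Real.exp (L * (b - a))) ^ 2 := by
      rw [mul_pow, ← Real.exp_nat_mul]
      push_cast
      ring_nf
    rw [e] at h1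
    exact (pow_le_pow_iff_left₀ (norm_nonneg _) (by positivity) two_ne_zero).1 h1
  · intro s hs
    refine (norm_sub_le _ _).trans ?_
    have h1 := hM s hs _ (hd.2 s) _ (hxR s hs)
    have h2 := hM s hs _ (hd.2 s) _ (hyR s hs)
    linarith
  · intro t ht
    have hsub : uIcc a t ⊆ uIcc a b := by
      rw [uIcc_of_le ht.1, uIcc_of_le hab]; exact Icc_subset_Icc le_rfl ht.2
    rw [intervalIntegral.integral_sub (hix.mono_set hsub) (hiy.mono_set hsub)]
    simp only [ContinuousMap.sub_apply]
    rw [hx t ht, hy t ht]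
    abel
  · intro s hs
    have h1 := hone s hs _ (hd.2 s) _ _ (hxR s hs) (hyR s hs)
    simp only [win_apply, add_zero] at h1
    rw [win_sub]
    simpa using h1

/-- cutoff -/
def cut (R s : ℝ) : ℝ := max 0 (min 1 (R + 2 - s))

lemma cut_nonneg (R s : ℝ) : 0 ≤ cut R s := le_max_left _ _
lemma cut_le_one (R s : ℝ) : cut R s ≤ 1 := max_le zero_le_one (min_le_left _ _)
lemma cut_one {R s : ℝ} (h : s ≤ R + 1) : cut R s = 1 := by
  unfold cut; rw [min_eq_left (by linarith)]; simp
lemma cut_zero {R s : ℝ} (h : R + 2 ≤ s) : cut R s = 0 := by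
  unfold cut; rw [max_eq_left ((min_le_right _ _).trans (by linarith))]
lemma cut_sub (R s t : ℝ) : |cut R s - cut R t| ≤ |s - t| := by
  have h : LipschitzWith 1 (fun u : ℝ => max 0 (min 1 u)) :=
    (LipschitzWith.id.const_min 1).const_max 0
  have := h.dist_le_mul (R + 2 - s) (R + 2 - t)
  rw [Real.dist_eq, Real.dist_eq] at this
  unfold cut
  rw [abs_sub_comm s t]
  simpa using this
lemma continuous_cut (R : ℝ) : Continuous (cut R) := by unfold cut; fun_prop

lemma trunc_reg {n l : ℕ} {r : ℝ} {D : Set (Euc l)}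
    {F : ℝ → Euc l → Hist n r → Euc n} (hF : RegF D F) (R : ℝ) :
    RegF D (fun s δ x => cut R ‖x‖ • F s δ x) := by
  constructor
  · intro d hd φ hφ
    exact AEStronglyMeasurable.smul (f := fun s => cut R ‖φ s‖)
      ((continuous_cut R).comp hφ.norm).aestronglyMeasurable (hF.meas d hd φ hφ)
  · intro s hs δ hδ
    exact ((continuous_cut R).comp continuous_norm).smul (hF.cont s hs δ hδ)

lemma trunc_bound {n r} {F : Hist n r → Euc n} {R M : ℝ} (hM0 : 0 ≤ M)
    (hM : ∀ x, ‖x‖ ≤ R + 2 → ‖F x‖ ≤ M) (x : Hist n r) : ‖cut R ‖x‖ • F x‖ ≤ M := by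
  rcases le_total ‖x‖ (R + 2) with h | h
  · rw [norm_smul, Real.norm_eq_abs, abs_of_nonneg (cut_nonneg _ _)]
    have := hM x h
    have h2 := mul_le_mul (cut_le_one R ‖x‖) this (norm_nonneg _) zero_le_one
    linarith
  · rw [cut_zero h, zero_smul, norm_zero]; exact hM0

lemma trunc_one {n : ℕ} {r : ℝ} (h0 : (0:ℝ) ∈ Icc (-r) 0) {F : Hist n r → Euc n} {R M L : ℝ}
    (hM0 : 0 ≤ M) (hL : 0 ≤ L)
    (hM : ∀ x, ‖x‖ ≤ R + 2 → ‖F x‖ ≤ M)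
    (hone : ∀ x y : Hist n r, ‖x‖ ≤ R + 2 → ‖y‖ ≤ R + 2 →
      ⟪x ⟨0, h0⟩ - y ⟨0, h0⟩, F x - F y⟫ ≤ L * ‖x - y‖ ^ 2) (x y : Hist n r) :
    ⟪x ⟨0, h0⟩ - y ⟨0, h0⟩, cut R ‖x‖ • F x - cut R ‖y‖ • F y⟫ ≤ (L + M) * ‖x - y‖ ^ 2 := by
  have hcut : |cut R ‖x‖ - cut R ‖y‖| ≤ ‖x - y‖ :=
    (cut_sub _ _ _).trans (abs_norm_sub_norm_le x y)
  have hp : ‖x ⟨0, h0⟩ - y ⟨0, h0⟩‖ ≤ ‖x - y‖ := (x - y).norm_coe_le_norm ⟨0, h0⟩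
  have gen : ∀ (c : ℝ) (v : Euc n), |c| ≤ ‖x - y‖ → ‖v‖ ≤ M →
      ⟪x ⟨0, h0⟩ - y ⟨0, h0⟩, c • v⟫ ≤ M * ‖x - y‖ ^ 2 := by
    intro c v hc hv
    refine (real_inner_le_norm _ _).trans ?_
    rw [norm_smul, Real.norm_eq_abs]
    have h1 : |c| * ‖v‖ ≤ ‖x - y‖ * M := mul_le_mul hc hv (norm_nonneg _) (norm_nonneg _)
    have h2 := mul_le_mul hp h1 (by positivity) (norm_nonneg _)
    linarith
  have hLn : 0 ≤ L * ‖x - y‖ ^ 2 := by positivity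
  rcases le_total ‖y‖ (R + 2) with hy | hy
  · rcases le_total ‖x‖ (R + 2) with hx | hx
    · have e : cut R ‖x‖ • F x - cut R ‖y‖ • F y = cut R ‖x‖ • (F x - F y) +
        (cut R ‖x‖ - cut R ‖y‖) • F y := by rw [smul_sub, sub_smul]; abel
      rw [e, inner_add_right, inner_smul_right]
      have h1 := gen _ _ hcut (hM y hy)
      have h2 := hone x y hx hy
      have h3 : cut R ‖x‖ * ⟪x ⟨0, h0⟩ - y ⟨0, h0⟩, F x - F y⟫ ≤ L * ‖x - y‖ ^ 2 := by
        refine (mul_le_mul_of_nonneg_left h2 (cut_nonneg _ _)).trans ?_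
        have := mul_le_mul_of_nonneg_right (cut_le_one R ‖x‖) hLn
        linarith
      linarith
    · rw [cut_zero hx] at hcut ⊢
      have h1 := gen _ _ hcut (hM y hy)
      have e : (0:ℝ) • F x - cut R ‖y‖ • F y = (0 - cut R ‖y‖) • F y := by simp
      rw [e]; linarith
  · rcases le_total ‖x‖ (R + 2) with hx | hx
    · rw [cut_zero hy] at hcut ⊢
      have h1 := gen _ _ hcut (hM x hx)
      have e : cut R ‖x‖ • F x - (0:ℝ) • F y = (cut R ‖x‖ - 0) • F x := by simp
      rw [e]; linarith
    · rw [cut_zero hx, cut_zero hy]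
      have : 0 ≤ M * ‖x - y‖ ^ 2 := by positivity
      simp only [zero_smul, sub_self, inner_zero_right]
      linarith

lemma lip_of_local {w : ℝ → ℝ} {a b C h₀ : ℝ} (hC : 0 ≤ C) (hh : 0 < h₀)
    (h : ∀ t ∈ Icc a b, ∀ e, 0 ≤ e → e ≤ h₀ → t + e ≤ b → |w (t + e) - w t| ≤ C * e) :
    LipschitzOnWith C.toNNReal w (Icc a b) := by
  have key : ∀ s ∈ Icc a b, ∀ t ∈ Icc a b, s ≤ t → |w t - w s| ≤ C * (t - s) := by
    intro s hs t ht hst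
    obtain ⟨N, hN⟩ := exists_nat_ge ((t - s) / h₀)
    set e := (t - s) / (N + 1) with he
    have hN1 : (0:ℝ) < N + 1 := by positivity
    have he0 : 0 ≤ e := div_nonneg (by linarith) hN1.le
    have heh : e ≤ h₀ := by
      rw [div_le_iff₀ hh] at hN
      rw [he, div_le_iff₀ hN1]
      nlinarith
    have heN : (N + 1) * e = t - s := by rw [he]; field_simp
    have ind : ∀ j : ℕ, j ≤ N + 1 → |w (s + j * e) - w s| ≤ C * (j * e) := by
      intro j
      induction j with
      | zero => intro _; simp
      | succ j ih =>
        intro hj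
        have hj' : (j:ℝ) + 1 ≤ N + 1 := by exact_mod_cast hj
        have hle : ((j:ℝ) + 1) * e ≤ t - s := by
          rw [← heN]; exact mul_le_mul_of_nonneg_right hj' he0
        have hj0 : (0:ℝ) ≤ j * e := by positivity
        have h1 := ih (by omega)
        have h2 := h (s + j * e) ⟨by linarith [hs.1], by nlinarith [ht.2]⟩ e he0 heh
          (by nlinarith [ht.2])
        have e1 : s + ((j + 1 : ℕ) : ℝ) * e = s + j * e + e := by push_cast; ring
        rw [e1]
        have h3 := abs_sub_le (w (s + j * e + e)) (w (s + j * e)) (w s)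
        push_cast
        nlinarith
    have := ind (N + 1) le_rfl
    push_cast at this
    rw [heN] at this
    simpa using this
  refine LipschitzOnWith.of_dist_le_mul ?_
  intro s hs t ht
  rw [Real.coe_toNNReal _ hC, Real.dist_eq, Real.dist_eq]
  rcases le_total s t with h | h
  · rw [abs_sub_comm, abs_sub_comm s, abs_of_nonneg (sub_nonneg.2 h)]; exact key s hs t ht h
  · rw [abs_of_nonneg (sub_nonneg.2 h)]; exact key t ht s hs h

lemma dini_bound {n : ℕ} {r : ℝ} (hr : 0 < r) (V : ℝ → Hist n r → ℝ) (x : C(ℝ, Euc n))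
    {t : ℝ} {v : Euc n} (hx : HasDerivAt x v t) {c : ℝ} (hc : diniH V t (win r x t) v ≤ (c : EReal))
    {w' : ℝ} (hw : HasDerivAt (fun τ => V τ (win r x τ)) w' t) : w' ≤ c := by
  set y : ℝ → Hist n r := fun h => h⁻¹ • (win r x (t + h) - Ehist h (win r x t) v) with hy
  have hy0 : Tendsto y (𝓝[>] (0:ℝ)) (𝓝 0) := by
    rw [Metric.tendsto_nhds]
    intro ε hε
    rw [hasDerivAt_iff_isLittleO_nhds_zero] at hx
    have h1 := hx.def (half_pos hε)
    rw [Metric.eventually_nhds_iff] at h1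
    obtain ⟨δ, hδ, h1⟩ := h1
    filter_upwards [Ioo_mem_nhdsGT (lt_min hδ hr)] with h hh
    have hhδ : h < δ := hh.2.trans_le (min_le_left _ _)
    have hhr : h < r := hh.2.trans_le (min_le_right _ _)
    have key : ‖win r x (t + h) - Ehist h (win r x t) v‖ ≤ ε / 2 * h := by
      rw [ContinuousMap.norm_le _ (mul_nonneg (half_pos hε).le hh.1.le)]
      intro θ
      have hneg : -r ≤ 0 := by linarith
      rw [ContinuousMap.sub_apply, win_apply, Ehist, dif_pos hneg]
      simp only [ContinuousMap.coe_mk]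
      have h3 := θ.2.1
      have h4 := θ.2.2
      split_ifs with h2
      · rw [projIcc_of_mem hneg (x := (θ:ℝ) + h) ⟨by linarith [hh.1], by linarith⟩, win_apply]
        simp only
        rw [show t + h + (θ:ℝ) = t + (θ + h) by ring, sub_self, norm_zero]
        exact mul_nonneg (half_pos hε).le hh.1.le
      · rw [projIcc_of_mem hneg (x := (0:ℝ)) ⟨hneg, le_rfl⟩, win_apply]
        simp only [add_zero]
        have hσ : 0 < (θ:ℝ) + h := by linarith [not_le.1 h2]
        have h5 := h1 (y := (θ:ℝ) + h) (by
          rw [dist_zero_right, Real.norm_eq_abs, abs_of_pos hσ]; linarith)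
        rw [Real.norm_eq_abs, abs_of_pos hσ] at h5
        rw [show t + h + (θ:ℝ) = t + (θ + h) by ring, ← sub_sub]
        refine h5.trans (mul_le_mul_of_nonneg_left (by linarith) (half_pos hε).le)
    rw [dist_zero_right, hy]
    simp only
    rw [norm_smul, norm_inv, Real.norm_eq_abs, abs_of_pos hh.1, inv_mul_lt_iff₀ hh.1]
    nlinarith [hh.1]
  have htend : Tendsto (fun h => (h, y h)) (𝓝[>] (0:ℝ)) ((𝓝[>] (0:ℝ)) ×ˢ 𝓝 0) :=
    tendsto_id.prodMk hy0
  refine le_of_forall_gt_imp_ge_of_dense ?_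
  intro c' hc'
  have hlt : diniH V t (win r x t) v < (c' : EReal) := hc.trans_lt (by exact_mod_cast hc')
  have hev := htend.eventually (eventually_lt_of_limsup_lt hlt)
  have hs := hasDerivAt_iff_tendsto_slope_zero.1 hw
  have hs2 := hs.mono_left (nhdsWithin_mono 0 (fun h (hh : h ∈ Ioi (0:ℝ)) => ne_of_gt hh))
  refine le_of_tendsto hs2 ?_
  filter_upwards [hev, self_mem_nhdsWithin] with h h1 hpos
  have hpos' : (0:ℝ) < h := hpos
  have e : Ehist h (win r x t) v + h • y h = win r x (t + h) := by
    rw [hy]; simp only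
    rw [smul_smul, mul_inv_cancel₀ hpos'.ne', one_smul]; abel
  simp only [e] at h1
  have h2 : (V (t + h) (win r x (t + h)) - V t (win r x t)) / h < c' := by exact_mod_cast h1
  rw [smul_eq_mul, inv_mul_eq_div]
  exact h2.le

lemma lyap_lip {n l : ℕ} {r : ℝ} (hr : 0 < r) {D : Set (Euc l)}
    {f : ℝ → Euc l → Hist n r → Euc n} (hF : RegF D f) {d : ℝ → Euc l} (hd : InMD D d)
    (hQ2 : ∀ T, 0 ≤ T → ∀ R, 0 ≤ R → ∃ M, ∀ t ∈ Icc (0:ℝ) T, ∀ d ∈ D,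
      ∀ x : Hist n r, ‖x‖ ≤ R → ‖f t d x‖ ≤ M)
    (V : ℝ → Hist n r → ℝ) (hVpos : ∀ t x, 0 ≤ V t x)
    (hAL : AlmostLipschitzOn r V) (q ρ : ℝ → ℝ) (hq : IsClassE q) (hρ : IsPosDef ρ)
    (hVdecr : ∀ t : ℝ, 0 ≤ t → ∀ x : Hist n r, ∀ d ∈ D,
      diniH V t x (f t d x) ≤ ((-ρ (V t x) + q t : ℝ) : EReal))
    {t₀ T : ℝ} (ht₀ : 0 ≤ t₀) (hT : t₀ ≤ T) (x : C(ℝ, Euc n)) {K : NNReal}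
    (hK : LipschitzWith K x)
    (hx : ∀ t ∈ Icc t₀ T, x t = x t₀ + ∫ s in t₀..t, f s (d s) (win r x s)) :
    ∀ s t, t₀ ≤ s → s ≤ t → t ≤ T → V t (win r x t) - V s (win r x s) ≤
      ∫ τ in s..t, (-ρ (V τ (win r x τ)) + q τ) := by
  obtain ⟨hVc, LV, P, G, hLVm, hPm, hGm, hG1, hP1, hP2⟩ := hAL
  obtain ⟨B, hB⟩ := (isCompact_Icc (a := t₀) (b := T)).exists_bound_of_continuousOn
    (continuous_win r x).continuousOn
  have hB0 : 0 ≤ B := (norm_nonneg _).trans (hB t₀ ⟨le_rfl, hT⟩)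
  set R := max B T with hR
  have hR0 : 0 ≤ R := hB0.trans (le_max_left _ _)
  have hBR : B ≤ R := le_max_left _ _
  have hTR : T ≤ R := le_max_right _ _
  have hG0 : 0 < G (R + K) := zero_lt_one.trans_le (hG1 _)
  have hlip : LipschitzOnWith (|LV R| * K + |P R| * (1 + K)).toNNReal
      (fun τ => V τ (win r x τ)) (Icc t₀ T) := by
    refine lip_of_local (h₀ := 1 / G (R + K)) (by positivity) (by positivity) ?_
    intro t ht e he0 heh hte
    have hwK : LipschitzWith (Real.toNNReal K) (fun θ : Icc (-r) (0:ℝ) => win r x t θ) := by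
      rw [Real.toNNReal_coe]
      refine LipschitzWith.of_dist_le_mul fun θ θ' => ?_
      rw [win_apply, win_apply]
      have := hK.dist_le_mul (t + θ) (t + θ')
      rw [Real.dist_eq] at this
      rw [Subtype.dist_eq, Real.dist_eq]
      simpa using this
    have h1 := hP2 R hR0 K K.coe_nonneg (win r x t) ((hB t ht).trans hBR) hwK t
      ⟨ht₀.trans ht.1, ht.2.trans hTR⟩ e he0 heh
    have h2 := hP1 R hR0 (t + e) ⟨by linarith [ht.1], hte.trans hTR⟩ (win r x t) (win r x (t + e))
      ((hB t ht).trans hBR) ((hB (t + e) ⟨by linarith [ht.1], hte⟩).trans hBR)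
    have h3 := win_shift_le (r := r) x hK (t + e) t
    rw [add_sub_cancel_left, abs_of_nonneg he0] at h3
    have h4 : LV R * ‖win r x (t + e) - win r x t‖ ≤ |LV R| * (K * e) :=
      mul_le_mul (le_abs_self _) h3 (norm_nonneg _) (abs_nonneg _)
    have h5 : e * P R * (1 + K) ≤ |P R| * (1 + K) * e := by
      have : P R * ((1 + K) * e) ≤ |P R| * ((1 + K) * e) :=
        mul_le_mul_of_nonneg_right (le_abs_self _) (by positivity)
      linarith
    have h6 := abs_sub_le (V (t + e) (win r x (t + e))) (V (t + e) (win r x t)) (V t (win r x t))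
    linarith
  obtain ⟨M, hM⟩ := hQ2 T (ht₀.trans hT) B hB0
  have hgi := hF.intble hd (continuous_win r x) ht₀ hT
    (fun s hs => hM s ⟨ht₀.trans hs.1, hs.2⟩ _ (hd.2 s) _ (hB s hs))
  have hae := ae_hasDerivAt_of_integral hT hgi hx
  intro s t hs hst ht
  have hsub : Icc s t ⊆ Icc t₀ T := Icc_subset_Icc hs ht
  refine ftc_le (w := fun τ => V τ (win r x τ)) hst (hlip.mono hsub) ?_ ?_
  · apply ContinuousOn.intervalIntegrable
    rw [uIcc_of_le hst]
    have hwc : ContinuousOn (fun τ => V τ (win r x τ)) (Icc s t) :=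
      hlip.continuousOn.mono hsub
    have h0 : ∀ τ ∈ Icc s t, (0:ℝ) ≤ τ := fun τ hτ => ht₀.trans (hs.trans hτ.1)
    exact ((hρ.1.comp hwc (fun τ _ => hVpos _ _)).neg).add (hq.1.mono h0)
  · filter_upwards [hae] with τ hτ hm w' hw'
    have h1 := hτ (hsub hm)
    exact dini_bound hr V x h1.2 (hVdecr τ (ht₀.trans (hsub hm).1) _ _ (hd.2 τ)) hw'

/-- Bundle of the standing hypotheses. -/
structure SysHyp {n l : ℕ} (r : ℝ) (D : Set (Euc l)) (f : ℝ → Euc l → Hist n r → Euc n)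
    (V : ℝ → Hist n r → ℝ) (a₁ a₂ β μ q ρ : ℝ → ℝ) : Prop where
  hr : 0 < r
  h0 : (0:ℝ) ∈ Icc (-r) 0
  reg : RegF D f
  one : ∀ T, 0 ≤ T → ∀ R, 0 ≤ R → ∃ L, 0 ≤ L ∧ ∀ t ∈ Icc (0:ℝ) T, ∀ d ∈ D,
      ∀ x y : Hist n r, ‖x‖ ≤ R → ‖y‖ ≤ R →
        ⟪x ⟨0, h0⟩ - y ⟨0, h0⟩, f t d x - f t d y⟫ ≤ L * ‖x - y‖ ^ 2
  bdd : ∀ T, 0 ≤ T → ∀ R, 0 ≤ R → ∃ M, 0 ≤ M ∧ ∀ t ∈ Icc (0:ℝ) T, ∀ d ∈ D,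
      ∀ x : Hist n r, ‖x‖ ≤ R → ‖f t d x‖ ≤ M
  Vpos : ∀ t x, 0 ≤ V t x
  AL : AlmostLipschitzOn r V
  ka₁ : IsKinf a₁
  ka₂ : IsKinf a₂
  kβ : IsKplus β
  kμ : IsKplus μ
  kq : IsClassE q
  kρ : IsPosDef ρ
  Vlow : ∀ t : ℝ, 0 ≤ t → ∀ x : Hist n r, a₁ (μ t * ‖x‖) ≤ V t x
  Vup : ∀ t : ℝ, 0 ≤ t → ∀ x : Hist n r, V t x ≤ a₂ (β t * ‖x‖)
  Vdecr : ∀ t : ℝ, 0 ≤ t → ∀ x : Hist n r, ∀ d ∈ D,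
      diniH V t x (f t d x) ≤ ((-ρ (V t x) + q t : ℝ) : EReal)

/-- The integral Lyapunov estimate. -/
def Est {n : ℕ} {r : ℝ} (V : ℝ → Hist n r → ℝ) (q ρ : ℝ → ℝ) (x : C(ℝ, Euc n)) (t₀ T : ℝ) : Prop :=
  ∀ s t, t₀ ≤ s → s ≤ t → t ≤ T →
    V t (win r x t) + ∫ τ in s..t, ρ (V τ (win r x τ)) ≤ V s (win r x s) + ∫ τ in s..t, q τ

lemma q_intble {q : ℝ → ℝ} (hq : IsClassE q) {s t : ℝ} (hs : 0 ≤ s) (hst : s ≤ t) :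
    IntervalIntegrable q volume s t := by
  apply ContinuousOn.intervalIntegrable
  rw [uIcc_of_le hst]
  exact hq.1.mono (fun τ hτ => hs.trans hτ.1)

lemma q_le {q : ℝ → ℝ} (hq : IsClassE q) {s t u : ℝ} (hu : 0 ≤ u) (hs : u ≤ s) (hst : s ≤ t) :
    ∫ τ in s..t, q τ ≤ ∫ τ in Ici u, q τ := by
  rw [intervalIntegral.integral_of_le hst]
  apply setIntegral_mono_set (hq.2.2.1.mono_set (Ici_subset_Ici.2 hu))
  · exact (ae_restrict_iff' measurableSet_Ici).2 (Eventually.of_forall fun τ hτ => hq.2.1 τ (hu.trans hτ))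
  · exact Eventually.of_forall fun τ hτ => hs.trans hτ.1.le

section
variable {n l : ℕ} {r : ℝ} {D : Set (Euc l)} {f : ℝ → Euc l → Hist n r → Euc n}
    {V : ℝ → Hist n r → ℝ} {a₁ a₂ β μ q ρ : ℝ → ℝ}

lemma V_cont (h : SysHyp r D f V a₁ a₂ β μ q ρ) (x : C(ℝ, Euc n)) :
    ContinuousOn (fun τ => V τ (win r x τ)) (Ici 0) :=
  h.AL.1.comp (f := fun τ => (τ, win r x τ)) (continuous_id.prodMk (continuous_win r x)).continuousOn
    (fun τ hτ => ⟨hτ, mem_univ _⟩)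

lemma ρV_cont (h : SysHyp r D f V a₁ a₂ β μ q ρ) (x : C(ℝ, Euc n)) :
    ContinuousOn (fun τ => ρ (V τ (win r x τ))) (Ici 0) :=
  h.kρ.1.comp (V_cont h x) (fun _ _ => h.Vpos _ _)

lemma ρV_intble (h : SysHyp r D f V a₁ a₂ β μ q ρ) (x : C(ℝ, Euc n)) {s t : ℝ} (hs : 0 ≤ s)
    (hst : s ≤ t) : IntervalIntegrable (fun τ => ρ (V τ (win r x τ))) volume s t := by
  apply ContinuousOn.intervalIntegrable
  rw [uIcc_of_le hst]
  exact (ρV_cont h x).mono (fun τ hτ => hs.trans hτ.1)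

lemma Est.le (h : SysHyp r D f V a₁ a₂ β μ q ρ) {x : C(ℝ, Euc n)} {t₀ T : ℝ}
    (hx : Est V q ρ x t₀ T) (ht₀ : 0 ≤ t₀) {s t : ℝ} (h1 : t₀ ≤ s) (h2 : s ≤ t) (h3 : t ≤ T) :
    V t (win r x t) ≤ V s (win r x s) + ∫ τ in s..t, q τ := by
  have := hx s t h1 h2 h3
  have h4 : 0 ≤ ∫ τ in s..t, ρ (V τ (win r x τ)) :=
    intervalIntegral.integral_nonneg h2 (fun τ _ => h.kρ.2.2.2 _ (h.Vpos _ _))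
  linarith

lemma V_init (h : SysHyp r D f V a₁ a₂ β μ q ρ) {T s : ℝ} (hT : 0 ≤ T) (hs : 0 ≤ s) :
    ∃ B, 0 ≤ B ∧ ∀ t₀ ∈ Icc (0:ℝ) T, ∀ x₀ : Hist n r, ‖x₀‖ ≤ s → V t₀ x₀ ≤ B := by
  obtain ⟨b, hb⟩ := (isCompact_Icc (a := (0:ℝ)) (b := T)).exists_bound_of_continuousOn
    (h.kβ.1.mono (fun t ht => ht.1))
  have hb0 : 0 ≤ b := (norm_nonneg _).trans (hb 0 ⟨le_rfl, hT⟩)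
  refine ⟨a₂ (b * s), ?_, ?_⟩
  · have := h.ka₂.2.1.monotoneOn (mem_Ici.2 le_rfl) (mem_Ici.2 (by positivity : 0 ≤ b * s)) (by positivity)
    rwa [h.ka₂.2.2.1] at this
  intro t₀ ht₀ x₀ hx₀
  refine (h.Vup t₀ ht₀.1 x₀).trans ?_
  have hβ := h.kβ.2 t₀ ht₀.1
  apply h.ka₂.2.1.monotoneOn (mem_Ici.2 (by positivity)) (mem_Ici.2 (by positivity))
  exact mul_le_mul ((le_abs_self _).trans (hb t₀ ht₀)) hx₀ (norm_nonneg _) hb0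

lemma state_bound (h : SysHyp r D f V a₁ a₂ β μ q ρ) {T s : ℝ} (hT : 0 ≤ T) (hs : 0 ≤ s) :
    ∃ R, 0 ≤ R ∧ s ≤ R ∧ ∀ t ∈ Icc (0:ℝ) T, ∀ t₀ ∈ Icc (0:ℝ) T, ∀ x₀ : Hist n r, ‖x₀‖ ≤ s →
      ∀ x : Hist n r, V t x ≤ V t₀ x₀ + ∫ τ in Ici (0:ℝ), q τ → ‖x‖ ≤ R := by
  obtain ⟨B, hB0, hB⟩ := V_init h hT hs
  obtain ⟨b, hb1, hb2⟩ := ((h.ka₁.2.2.2.eventually_gt_atTop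
    (B + ∫ τ in Ici (0:ℝ), q τ)).and (eventually_ge_atTop 0)).exists
  obtain ⟨m, hm, hmin⟩ := (isCompact_Icc (a := (0:ℝ)) (b := T)).exists_isMinOn ⟨0, le_rfl, hT⟩
    (h.kμ.1.mono (fun t ht => ht.1))
  have hμm := h.kμ.2 m hm.1
  refine ⟨max s (b / μ m), hs.trans (le_max_left _ _), le_max_left _ _, ?_⟩
  intro t ht t₀ ht₀ x₀ hx₀ x hx
  refine le_trans ?_ (le_max_right _ _)
  have hμt := h.kμ.2 t ht.1
  have h1 : a₁ (μ t * ‖x‖) < a₁ b := by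
    have := h.Vlow t ht.1 x
    have := hB t₀ ht₀ x₀ hx₀
    linarith
  have h2 := (h.ka₁.2.1.lt_iff_lt (mem_Ici.2 (by positivity)) (mem_Ici.2 hb2)).1 h1
  rw [le_div_iff₀ hμm]
  have h3 : μ m ≤ μ t := hmin ht
  have := mul_le_mul_of_nonneg_right h3 (norm_nonneg x)
  linarith

lemma est_of_lip (h : SysHyp r D f V a₁ a₂ β μ q ρ) {d : ℝ → Euc l} (hd : InMD D d)
    {t₀ T : ℝ} (ht₀ : 0 ≤ t₀) (hT : t₀ ≤ T) (x : C(ℝ, Euc n)) {K : NNReal} (hK : LipschitzWith K x)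
    (hx : ∀ t ∈ Icc t₀ T, x t = x t₀ + ∫ s in t₀..t, f s (d s) (win r x s)) :
    Est V q ρ x t₀ T := by
  intro s t h1 h2 h3
  have := lyap_lip h.hr h.reg hd
    (fun T hT R hR => by obtain ⟨M, _, hM⟩ := h.bdd T hT R hR; exact ⟨M, hM⟩) V h.Vpos h.AL q ρ
    h.kq h.kρ h.Vdecr ht₀ hT x hK hx s t h1 h2 h3
  have e : ∫ τ in s..t, (-ρ (V τ (win r x τ)) + q τ)
      = -(∫ τ in s..t, ρ (V τ (win r x τ))) + ∫ τ in s..t, q τ := by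
    rw [← intervalIntegral.integral_neg]
    exact intervalIntegral.integral_add (ρV_intble h x (ht₀.trans h1) h2).neg
      (q_intble h.kq (ht₀.trans h1) h2)
  rw [e] at this
  linarith

lemma exists_lip_data (h : SysHyp r D f V a₁ a₂ β μ q ρ) {d : ℝ → Euc l} (hd : InMD D d)
    {t₀ T : ℝ} (ht₀ : 0 ≤ t₀) (hT : t₀ ≤ T) (x₀ : Hist n r) {K : NNReal} (hK : LipschitzWith K x₀) :
    ∃ x : C(ℝ, Euc n), win r x t₀ = x₀ ∧
      (∀ t ∈ Icc t₀ T, x t = x t₀ + ∫ s in t₀..t, f s (d s) (win r x s)) ∧ Est V q ρ x t₀ T := by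
  have hT0 : 0 ≤ T := ht₀.trans hT
  obtain ⟨R, hR0, hsR, hR⟩ := state_bound h hT0 (norm_nonneg x₀)
  obtain ⟨M, hM0, hM⟩ := h.bdd T hT0 (R + 2) (by linarith)
  obtain ⟨L, hL0, hL⟩ := h.one T hT0 (R + 2) (by linarith)
  have hsub : ∀ s ∈ Icc t₀ T, s ∈ Icc 0 T := fun s hs => ⟨ht₀.trans hs.1, hs.2⟩
  obtain ⟨x, ⟨K', hK'⟩, hx0, hx⟩ := exists_sol_lip h.hr h.h0 (trunc_reg h.reg R) hd ht₀ hT hM0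
    (add_nonneg hL0 hM0)
    (fun s hs δ hδ x => trunc_bound (F := f s δ) hM0 (hM s (hsub s hs) δ hδ) x)
    (fun s hs δ hδ x y => trunc_one h.h0 (F := f s δ) hM0 hL0 (hM s (hsub s hs) δ hδ)
      (hL s (hsub s hs) δ hδ) x y) x₀ hK
  -- solution of the original system as long as it stays in the ball
  have horig : ∀ T', t₀ ≤ T' → T' ≤ T → (∀ s ∈ Icc t₀ T', ‖win r x s‖ ≤ R + 1) →
      ∀ t ∈ Icc t₀ T', x t = x t₀ + ∫ s in t₀..t, f s (d s) (win r x s) := by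
    intro T' h1 h2 h3 t ht
    rw [hx t ⟨ht.1, ht.2.trans h2⟩]
    congr 1
    apply intervalIntegral.integral_congr
    intro s hs
    rw [uIcc_of_le ht.1] at hs
    simp only
    rw [cut_one (h3 s ⟨hs.1, hs.2.trans ht.2⟩), one_smul]
  have hball : ∀ s ∈ Icc t₀ T, ‖win r x s‖ ≤ R + 1 := by
    by_contra hcon
    push Not at hcon
    obtain ⟨s₁, hs₁, hs₁'⟩ := hcon
    have hcomp : IsCompact (Icc t₀ T ∩ {s | R + 1 ≤ ‖win r x s‖}) :=
      isCompact_Icc.inter_right (isClosed_le continuous_const (continuous_win r x).norm)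
    obtain ⟨σ, hσ, hmin⟩ := hcomp.exists_isLeast ⟨s₁, hs₁, hs₁'.le⟩
    have hlt : ∀ s ∈ Ico t₀ σ, ‖win r x s‖ < R + 1 := by
      intro s hs
      by_contra hc
      exact absurd (hmin ⟨⟨hs.1, hs.2.le.trans hσ.1.2⟩, not_lt.1 hc⟩) (not_le.2 hs.2)
    have hlt' : ∀ s ∈ Icc t₀ σ, ‖win r x s‖ ≤ R + 1 := by
      have h1 : t₀ < σ := by
        rcases eq_or_lt_of_le hσ.1.1 with he | he
        · exfalso
          have hh : R + 1 ≤ ‖win r x σ‖ := hσ.2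
          rw [← he, hx0] at hh
          linarith
        · exact he
      intro s hs
      have hcl : s ∈ closure (Ico t₀ σ) := by rw [closure_Ico h1.ne]; exact hs
      exact closure_minimal (s := Ico t₀ σ) (t := {s | ‖win r x s‖ ≤ R + 1})
        (fun s hs => (hlt s hs).le) (isClosed_le (continuous_win r x).norm continuous_const) hcl
    have hest := est_of_lip h hd ht₀ hσ.1.1 x hK' (horig σ hσ.1.1 hσ.1.2 hlt')
    have h1 := hest.le h ht₀ le_rfl hσ.1.1 le_rfl
    have h2 := q_le h.kq le_rfl ht₀ hσ.1.1
    rw [hx0] at h1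
    have h3 := hR σ (hsub σ hσ.1) t₀ ⟨ht₀, hT⟩ x₀ le_rfl (win r x σ) (by linarith)
    have h4 : R + 1 ≤ ‖win r x σ‖ := hσ.2
    linarith
  have ho := horig T hT le_rfl hball
  exact ⟨x, hx0, ho, est_of_lip h hd ht₀ hT x hK' ho⟩

lemma exists_lip_approx (hr : 0 < r) (x₀ : Hist n r) {ε : ℝ} (hε : 0 < ε) :
    ∃ y : Hist n r, (∃ K, LipschitzWith K y) ∧ ‖y - x₀‖ ≤ ε := by
  have hneg : -r ≤ 0 := by linarith
  set X : ℝ → Euc n := IccExtend hneg x₀ with hX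
  have hXu : UniformContinuous X :=
    (CompactSpace.uniformContinuous_of_continuous x₀.continuous).comp
      (LipschitzWith.projIcc hneg).uniformContinuous
  have hXc : Continuous X := hXu.continuous
  obtain ⟨δ, hδ, hδX⟩ := Metric.uniformContinuous_iff.1 hXu ε hε
  set e := δ / 2 with he
  have he0 : 0 < e := by positivity
  have hXb : ∀ t, ‖X t‖ ≤ ‖x₀‖ := fun t => x₀.norm_coe_le_norm _
  have hi : ∀ a b, IntervalIntegrable X volume a b := fun a b => hXc.intervalIntegrable _ _
  have hΦ : LipschitzWith ‖x₀‖₊ (fun t => ∫ s in (0:ℝ)..t, X s) := by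
    refine LipschitzWith.of_dist_le_mul fun s t => ?_
    rw [dist_eq_norm, intervalIntegral.integral_interval_sub_left (hi _ _) (hi _ _), Real.dist_eq]
    exact intervalIntegral.norm_integral_le_of_norm_le_const (fun τ _ => hXb τ)
  have hS : LipschitzWith (‖e⁻¹‖₊ * (‖x₀‖₊ + ‖x₀‖₊)) (fun t : ℝ => e⁻¹ • ((∫ s in (0:ℝ)..(t + e), X s) - ∫ s in (0:ℝ)..t, X s)) := by
    have h1 : LipschitzWith (‖x₀‖₊ * (1 + 0)) (fun t : ℝ => ∫ s in (0:ℝ)..(t + e), X s) :=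
      hΦ.comp (LipschitzWith.id.add (LipschitzWith.const e))
    simp only [add_zero, mul_one] at h1
    exact (lipschitzWith_smul e⁻¹).comp (h1.sub hΦ)
  refine ⟨⟨fun θ => e⁻¹ • ((∫ s in (0:ℝ)..(θ + e), X s) - ∫ s in (0:ℝ)..θ, X s),
    hS.continuous.comp continuous_subtype_val⟩, ⟨_, hS.comp (LipschitzWith.subtype_val _)⟩, ?_⟩
  rw [ContinuousMap.norm_le _ hε.le]
  intro θ
  have hθ : x₀ θ = X θ := by rw [hX, IccExtend_val]
  have e1 : x₀ θ = e⁻¹ • ∫ s in (θ:ℝ)..(θ + e), X θ := by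
    rw [intervalIntegral.integral_const, add_sub_cancel_left, smul_smul, inv_mul_cancel₀ he0.ne',
      one_smul, hθ]
  rw [ContinuousMap.sub_apply, ContinuousMap.coe_mk,
    intervalIntegral.integral_interval_sub_left (hi _ _) (hi _ _), e1, ← smul_sub,
    ← intervalIntegral.integral_sub (hi _ _) (by simp), norm_smul, norm_inv, Real.norm_eq_abs,
    abs_of_pos he0, inv_mul_le_iff₀ he0]
  have := intervalIntegral.norm_integral_le_of_norm_le_const (a := (θ:ℝ)) (b := θ + e)
    (f := fun s => X s - X θ) (C := ε) (fun s hs => by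
      rw [uIoc_of_le (by linarith)] at hs
      rw [← dist_eq_norm]
      refine (hδX ?_).le
      rw [Real.dist_eq, abs_of_nonneg (by linarith [hs.1])]
      linarith [hs.2])
  rw [add_sub_cancel_left, abs_of_pos he0] at this
  linarith
end

section
variable {n l : ℕ} {r : ℝ} {D : Set (Euc l)} {f : ℝ → Euc l → Hist n r → Euc n}
    {V : ℝ → Hist n r → ℝ} {a₁ a₂ β μ q ρ : ℝ → ℝ}

lemma win_congr {x y : C(ℝ, Euc n)} {t : ℝ} (h : ∀ s, t - r ≤ s → s ≤ t → x s = y s) :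
    win r x t = win r y t := by
  ext1 θ
  rw [win_apply, win_apply]
  exact h _ (by linarith [θ.2.1]) (by linarith [θ.2.2])

lemma val_of_win {x y : C(ℝ, Euc n)} {t s : ℝ} (h : win r x t = win r y t) (h1 : t - r ≤ s)
    (h2 : s ≤ t) : x s = y s := by
  have := congrArg (fun w : Hist n r => w ⟨s - t, by linarith, by linarith⟩) h
  simpa [win_apply] using this

/-- solution on an interval together with the Lyapunov estimate. -/
def Good (f : ℝ → Euc l → Hist n r → Euc n) (V : ℝ → Hist n r → ℝ) (q ρ : ℝ → ℝ) (d : ℝ → Euc l)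
    (t₀ T : ℝ) (x₀ : Hist n r) (x : C(ℝ, Euc n)) : Prop :=
  win r x t₀ = x₀ ∧
    (∀ t ∈ Icc t₀ T, x t = x t₀ + ∫ s in t₀..t, f s (d s) (win r x s)) ∧ Est V q ρ x t₀ T

lemma good_congr (hr : 0 < r) {d : ℝ → Euc l} {t₀ T : ℝ} (hT : t₀ ≤ T) {x₀ : Hist n r}
    {x y : C(ℝ, Euc n)} (hx : Good f V q ρ d t₀ T x₀ x)
    (hxy : ∀ t ∈ Icc t₀ T, win r x t = win r y t) : Good f V q ρ d t₀ T x₀ y := by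
  have hv : ∀ t ∈ Icc t₀ T, x t = y t := fun t ht =>
    val_of_win (hxy t ht) (by linarith) le_rfl
  refine ⟨by rw [← hxy t₀ ⟨le_rfl, hT⟩]; exact hx.1, ?_, ?_⟩
  · intro t ht
    rw [← hv t ht, ← hv t₀ ⟨le_rfl, hT⟩, hx.2.1 t ht]
    congr 1
    apply intervalIntegral.integral_congr
    intro s hs
    rw [uIcc_of_le ht.1] at hs
    simp only
    rw [hxy s ⟨hs.1, hs.2.trans ht.2⟩]
  · intro s t h1 h2 h3
    have := hx.2.2 s t h1 h2 h3
    rw [hxy s ⟨h1, h2.trans h3⟩, hxy t ⟨h1.trans h2, h3⟩] at this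
    have e : ∫ τ in s..t, ρ (V τ (win r x τ)) = ∫ τ in s..t, ρ (V τ (win r y τ)) := by
      apply intervalIntegral.integral_congr
      intro τ hτ
      rw [uIcc_of_le h2] at hτ
      simp only
      rw [hxy τ ⟨h1.trans hτ.1, hτ.2.trans h3⟩]
    rwa [e] at this

lemma sol_unique (h : SysHyp r D f V a₁ a₂ β μ q ρ) {d : ℝ → Euc l} (hd : InMD D d)
    {t₀ T : ℝ} (ht₀ : 0 ≤ t₀) (hT : t₀ ≤ T) (x y : C(ℝ, Euc n))
    (hx : ∀ t ∈ Icc t₀ T, x t = x t₀ + ∫ s in t₀..t, f s (d s) (win r x s))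
    (hy : ∀ t ∈ Icc t₀ T, y t = y t₀ + ∫ s in t₀..t, f s (d s) (win r y s))
    (hxy : win r x t₀ = win r y t₀) : ∀ t ∈ Icc t₀ T, win r x t = win r y t := by
  obtain ⟨R₁, hR₁⟩ := (isCompact_Icc (a := t₀) (b := T)).exists_bound_of_continuousOn
    (continuous_win r x).continuousOn
  obtain ⟨R₂, hR₂⟩ := (isCompact_Icc (a := t₀) (b := T)).exists_bound_of_continuousOn
    (continuous_win r y).continuousOn
  have hR0 : 0 ≤ max R₁ R₂ := (norm_nonneg _).trans ((hR₁ t₀ ⟨le_rfl, hT⟩).trans (le_max_left _ _))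
  obtain ⟨M, hM0, hM⟩ := h.bdd T (ht₀.trans hT) _ hR0
  obtain ⟨L, hL0, hL⟩ := h.one T (ht₀.trans hT) _ hR0
  intro t ht
  have := cont_dep h.hr h.h0 h.reg hd ht₀ hT hM0 hL0
    (fun s hs => hM s ⟨ht₀.trans hs.1, hs.2⟩) (fun s hs => hL s ⟨ht₀.trans hs.1, hs.2⟩) x y
    (fun s hs => (hR₁ s hs).trans (le_max_left _ _))
    (fun s hs => (hR₂ s hs).trans (le_max_right _ _)) hx hy t ht
  rw [hxy, sub_self, norm_zero, zero_mul] at this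
  exact sub_eq_zero.1 (norm_le_zero_iff.1 this)

lemma good_bound (h : SysHyp r D f V a₁ a₂ β μ q ρ) {d : ℝ → Euc l} {t₀ T : ℝ} (ht₀ : 0 ≤ t₀)
    {x₀ : Hist n r} {x : C(ℝ, Euc n)} (hx : Good f V q ρ d t₀ T x₀ x) {t : ℝ}
    (ht : t ∈ Icc t₀ T) : V t (win r x t) ≤ V t₀ x₀ + ∫ τ in Ici (0:ℝ), q τ := by
  have h1 := hx.2.2.le h ht₀ le_rfl ht.1 ht.2
  have h2 := q_le h.kq le_rfl ht₀ ht.1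
  rw [hx.1] at h1
  linarith

lemma exists_gen (h : SysHyp r D f V a₁ a₂ β μ q ρ) {d : ℝ → Euc l} (hd : InMD D d)
    {t₀ T : ℝ} (ht₀ : 0 ≤ t₀) (hT : t₀ ≤ T) (x₀ : Hist n r) :
    ∃ x : C(ℝ, Euc n), Good f V q ρ d t₀ T x₀ x := by
  have hT0 : 0 ≤ T := ht₀.trans hT
  have hr := h.hr
  have hex : ∀ k : ℕ, ∃ y : Hist n r, ∃ x : C(ℝ, Euc n), ‖y - x₀‖ ≤ 1 / ((k:ℝ) + 1) ∧
      Good f V q ρ d t₀ T y x := by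
    intro k
    obtain ⟨y, ⟨K, hK⟩, hy⟩ := exists_lip_approx h.hr x₀ (ε := 1 / ((k:ℝ) + 1)) (by positivity)
    obtain ⟨x, hx⟩ := exists_lip_data h hd ht₀ hT y hK
    exact ⟨y, x, hy, hx⟩
  choose y₀ x' hy₀ hx' using hex
  -- clamp
  let cl : C(ℝ, ℝ) := ⟨fun t => max (t₀ - r) (min T t), by fun_prop⟩
  let y : ℕ → C(ℝ, Euc n) := fun k => (x' k).comp cl
  have hy : ∀ k, Good f V q ρ d t₀ T (y₀ k) (y k) := by
    intro k
    refine good_congr h.hr hT (hx' k) (fun t ht => win_congr fun s h1 h2 => ?_)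
    show x' k s = x' k (max (t₀ - r) (min T s))
    rw [min_eq_right (h2.trans ht.2), max_eq_right (by linarith [ht.1])]
  have hy₀n : ∀ k, ‖y₀ k‖ ≤ ‖x₀‖ + 1 := by
    intro k
    have h1 : 1 / ((k:ℝ) + 1) ≤ 1 := by
      rw [div_le_one (by positivity)]
      linarith [(Nat.cast_nonneg k : (0:ℝ) ≤ k)]
    have := norm_le_norm_add_norm_sub' (y₀ k) x₀
    linarith [hy₀ k]
  obtain ⟨R, hR0, -, hR⟩ := state_bound h hT0 (by positivity : 0 ≤ ‖x₀‖ + 1)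
  obtain ⟨B, hB0, hB⟩ := V_init h hT0 (by positivity : 0 ≤ ‖x₀‖ + 1)
  have hyR : ∀ k, ∀ s ∈ Icc t₀ T, ‖win r (y k) s‖ ≤ R := fun k s hs =>
    hR s ⟨ht₀.trans hs.1, hs.2⟩ t₀ ⟨ht₀, hT⟩ (y₀ k) (hy₀n k) _ (good_bound h ht₀ (hy k) hs)
  obtain ⟨M, hM0, hM⟩ := h.bdd T hT0 R hR0
  obtain ⟨L, hL0, hL⟩ := h.one T hT0 R hR0
  set b : ℕ → ℝ := fun N => 2 * (1 / ((N:ℝ) + 1)) * Real.exp (L * (T - t₀)) with hb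
  have hblim : Tendsto b atTop (𝓝 0) := by
    have := (tendsto_one_div_add_atTop_nhds_zero_nat (𝕜 := ℝ)).const_mul 2 |>.mul_const
      (Real.exp (L * (T - t₀)))
    simpa [hb] using this
  have hcauchy : ∀ N k, N ≤ k → ∀ t, ‖y N t - y k t‖ ≤ b N := by
    intro N k hNk t
    set t' := max (t₀ - r) (min T t) with ht'
    have hty : ∀ j, y j t = y j t' := by
      intro j
      show x' j (max (t₀ - r) (min T t)) = x' j (max (t₀ - r) (min T t'))
      rw [← ht']
      congr 1
      have h1 : t' ≤ T := max_le (by linarith) (min_le_left _ _)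
      have h2 : t₀ - r ≤ t' := le_max_left _ _
      rw [min_eq_right h1, max_eq_right h2]
    have h1 : t' ≤ T := max_le (by linarith) (min_le_left _ _)
    have h2 : t₀ - r ≤ t' := le_max_left _ _
    have h3 := cont_dep h.hr h.h0 h.reg hd ht₀ hT hM0 hL0
      (fun s hs => hM s ⟨ht₀.trans hs.1, hs.2⟩) (fun s hs => hL s ⟨ht₀.trans hs.1, hs.2⟩) (y N) (y k)
      (hyR N) (hyR k) (hy N).2.1 (hy k).2.1 (max t₀ t') ⟨le_max_left _ _, max_le hT h1⟩
    have h4 := norm_le_win (r := r) (y N - y k) (t := max t₀ t') (s := t')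
      (by rw [sub_le_iff_le_add]; exact max_le (by linarith) (by linarith)) (le_max_right _ _)
    rw [win_sub] at h4
    rw [hty N, hty k]
    refine h4.trans (h3.trans ?_)
    rw [(hy N).1, (hy k).1, hb]
    refine mul_le_mul_of_nonneg_right ?_ (Real.exp_pos _).le
    have h5 : y₀ N - y₀ k = (y₀ N - x₀) - (y₀ k - x₀) := by abel
    have h6 : 1 / ((k:ℝ) + 1) ≤ 1 / ((N:ℝ) + 1) := by
      apply one_div_le_one_div_of_le (by positivity)
      have : (N:ℝ) ≤ k := by exact_mod_cast hNk
      linarith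
    rw [h5]
    have := norm_sub_le (y₀ N - x₀) (y₀ k - x₀)
    linarith [hy₀ N, hy₀ k]
  obtain ⟨z, hz⟩ := exists_unif_limit y b hblim hcauchy
  have hb0 : ∀ N, 0 ≤ b N := fun N => by rw [hb]; positivity
  have hwin : ∀ t, Tendsto (fun k => win r (y k) t) atTop (𝓝 (win r z t)) := by
    intro t
    rw [tendsto_iff_norm_sub_tendsto_zero]
    exact squeeze_zero (fun _ => norm_nonneg _) (fun k => win_dist_le _ _ (hb0 k) t (hz k)) hblim
  have hpt : ∀ t, Tendsto (fun k => y k t) atTop (𝓝 (z t)) := by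
    intro t
    rw [tendsto_iff_norm_sub_tendsto_zero]
    exact squeeze_zero (fun _ => norm_nonneg _) (fun k => hz k t) hblim
  refine ⟨z, ?_, ?_, ?_⟩
  · refine tendsto_nhds_unique (hwin t₀) ?_
    have : Tendsto y₀ atTop (𝓝 x₀) := by
      rw [tendsto_iff_norm_sub_tendsto_zero]
      exact squeeze_zero (fun _ => norm_nonneg _) hy₀ tendsto_one_div_add_atTop_nhds_zero_nat
    refine this.congr (fun k => ((hy k).1).symm)
  · exact limit_sol h.reg hd ht₀ y z (fun k => win r (y k)) (fun k => continuous_win r _) hpt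
      (fun s _ => hwin s)
      (fun k s hs => hM s ⟨ht₀.trans hs.1, hs.2⟩ (d s) (hd.2 s) _ (hyR k s hs))
      (fun k => (hy k).2.1)
  · intro s t h1 h2 h3
    have hVlim : ∀ τ, 0 ≤ τ → Tendsto (fun k => V τ (win r (y k) τ)) atTop (𝓝 (V τ (win r z τ))) := by
      intro τ hτ
      have hc : ContinuousOn (fun w : Hist n r => V τ w) univ :=
        h.AL.1.comp (f := fun w : Hist n r => (τ, w)) (by fun_prop) (fun w _ => ⟨hτ, mem_univ _⟩)
      exact ((continuousOn_univ.1 hc).tendsto _).comp (hwin τ)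
    set B' := B + ∫ τ in Ici (0:ℝ), q τ with hB'
    have hVB : ∀ k, ∀ τ ∈ Icc t₀ T, V τ (win r (y k) τ) ∈ Icc 0 B' := by
      intro k τ hτ
      refine ⟨h.Vpos _ _, ?_⟩
      have := good_bound h ht₀ (hy k) hτ
      linarith [hB t₀ ⟨ht₀, hT⟩ (y₀ k) (hy₀n k)]
    obtain ⟨C, hC⟩ := (isCompact_Icc (a := (0:ℝ)) (b := B')).exists_bound_of_continuousOn
      (h.kρ.1.mono (fun t ht => ht.1))
    have hI : Tendsto (fun k => ∫ τ in s..t, ρ (V τ (win r (y k) τ))) atTop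
        (𝓝 (∫ τ in s..t, ρ (V τ (win r z τ)))) := by
      apply intervalIntegral.tendsto_integral_filter_of_dominated_convergence (fun _ => C)
      · refine Eventually.of_forall fun k => ?_
        have := ρV_intble h (y k) (ht₀.trans h1) h2
        rw [intervalIntegrable_iff] at this
        exact this.aestronglyMeasurable
      · refine Eventually.of_forall fun k => Eventually.of_forall fun τ hτ => ?_
        rw [uIoc_of_le h2] at hτ
        exact hC _ (hVB k τ ⟨h1.trans hτ.1.le, hτ.2.trans h3⟩)
      · exact intervalIntegrable_const
      · refine Eventually.of_forall fun τ hτ => ?_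
        rw [uIoc_of_le h2] at hτ
        have hτ0 : 0 ≤ τ := ht₀.trans (h1.trans hτ.1.le)
        have hρ := h.kρ.1 (V τ (win r z τ)) (h.Vpos _ _)
        exact hρ.tendsto.comp (tendsto_nhdsWithin_iff.2 ⟨hVlim τ hτ0,
          Eventually.of_forall fun k => h.Vpos _ _⟩)
    exact le_of_tendsto_of_tendsto' ((hVlim t (ht₀.trans (h1.trans h2))).add hI)
      ((hVlim s (ht₀.trans h1)).add_const _) (fun k => (hy k).2.2 s t h1 h2 h3)

lemma exists_global (h : SysHyp r D f V a₁ a₂ β μ q ρ) {d : ℝ → Euc l} (hd : InMD D d)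
    {t₀ : ℝ} (ht₀ : 0 ≤ t₀) (x₀ : Hist n r) :
    ∃ x : C(ℝ, Euc n), ∀ T, t₀ ≤ T → Good f V q ρ d t₀ T x₀ x := by
  have hr := h.hr
  have hex : ∀ k : ℕ, ∃ x : C(ℝ, Euc n), Good f V q ρ d t₀ (t₀ + k) x₀ x := fun k =>
    exists_gen h hd ht₀ (by linarith [(Nat.cast_nonneg k : (0:ℝ) ≤ k)]) x₀
  choose x hx using hex
  have hagree' : ∀ j k : ℕ, j ≤ k → ∀ t, t₀ - r ≤ t → t ≤ t₀ + j → x j t = x k t := by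
    intro j k hjk t h1 h2
    have hjk' : (j:ℝ) ≤ k := by exact_mod_cast hjk
    have hj0 : (0:ℝ) ≤ j := Nat.cast_nonneg j
    have := sol_unique h hd ht₀ (T := t₀ + j) (by linarith) (x j) (x k) (hx j).2.1
      (fun t ht => (hx k).2.1 t ⟨ht.1, by linarith [ht.2]⟩) (by rw [(hx j).1, (hx k).1])
      (max t₀ t) ⟨le_max_left _ _, max_le (by linarith) h2⟩
    exact val_of_win this (by rw [sub_le_iff_le_add]; exact max_le (by linarith) (by linarith))
      (le_max_right _ _)
  have hagree : ∀ j k : ℕ, ∀ t, t₀ - r ≤ t → t ≤ t₀ + j → t ≤ t₀ + k → x j t = x k t := by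
    intro j k t h1 h2 h3
    rcases le_total j k with hjk | hjk
    · exact hagree' j k hjk t h1 h2
    · exact (hagree' k j hjk t h1 h3).symm
  let X : ℝ → Euc n := fun t => x ⌈t - t₀⌉₊ (max t (t₀ - r))
  have hXk : ∀ k : ℕ, ∀ t, t ≤ t₀ + k → X t = x k (max t (t₀ - r)) := by
    intro k t ht
    have h1 := Nat.le_ceil (t - t₀)
    have h2 : (0:ℝ) ≤ (⌈t - t₀⌉₊ : ℝ) := Nat.cast_nonneg _
    have h3 : (0:ℝ) ≤ k := Nat.cast_nonneg _
    exact hagree _ k _ (le_max_right _ _) (max_le (by linarith) (by linarith))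
      (max_le ht (by linarith))
  have hXc : Continuous X := by
    rw [continuous_iff_continuousAt]
    intro t
    obtain ⟨k, hk⟩ := exists_nat_gt (t - t₀)
    have hc : Continuous (fun t => x k (max t (t₀ - r))) := by fun_prop
    refine hc.continuousAt.congr ?_
    filter_upwards [Iio_mem_nhds (show t < t₀ + k by linarith)] with s hs
    exact (hXk k s (le_of_lt hs)).symm
  refine ⟨⟨X, hXc⟩, fun T hT => ?_⟩
  obtain ⟨k, hk⟩ := exists_nat_gt (T - t₀)
  have hg : Good f V q ρ d t₀ T x₀ (x k) := ⟨(hx k).1,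
    fun t ht => (hx k).2.1 t ⟨ht.1, by linarith [ht.2]⟩,
    fun s t h1 h2 h3 => (hx k).2.2 s t h1 h2 (by linarith)⟩
  refine good_congr hr hT hg (fun t ht => win_congr fun s h1 h2 => ?_)
  show x k s = X s
  rw [hXk k s (by linarith [ht.2]), max_eq_left (by linarith [ht.1])]
end

lemma q_tail {q : ℝ → ℝ} (hq : IsClassE q) {e : ℝ} (he : 0 < e) :
    ∃ T, 0 ≤ T ∧ ∫ τ in Ici T, q τ ≤ e := by
  have h1 := tendsto_setIntegral_of_antitone (μ := volume) (f := q) (s := fun k : ℕ => Ici (k:ℝ))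
    (fun _ => measurableSet_Ici)
    (fun i j hij => Ici_subset_Ici.2 (by exact_mod_cast hij)) ⟨0, by simpa using hq.2.2.1⟩
  have h2 : ⋂ k : ℕ, Ici (k:ℝ) = ∅ := by
    ext t
    simp only [mem_iInter, mem_Ici, mem_empty_iff_false, iff_false, not_forall, not_le]
    exact exists_nat_gt t
  rw [h2, setIntegral_empty] at h1
  obtain ⟨k, hk⟩ := (h1.eventually_lt_const he).exists
  exact ⟨k, Nat.cast_nonneg k, hk.le⟩

section
variable {n l : ℕ} {r : ℝ} {D : Set (Euc l)} {f : ℝ → Euc l → Hist n r → Euc n}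
    {V : ℝ → Hist n r → ℝ} {a₁ a₂ β μ q ρ : ℝ → ℝ}

lemma q_int_nonneg {q : ℝ → ℝ} (hq : IsClassE q) : 0 ≤ ∫ τ in Ici (0:ℝ), q τ :=
  setIntegral_nonneg measurableSet_Ici (fun τ hτ => hq.2.1 τ hτ)

lemma decay (h : SysHyp r D f V a₁ a₂ β μ q ρ) {e B T₁ : ℝ} (he : 0 < e) (hB : 0 ≤ B)
    (hT₁ : 0 ≤ T₁) (htail : ∫ τ in Ici T₁, q τ ≤ e / 2) :
    ∃ τ, 0 ≤ τ ∧ ∀ t₀, 0 ≤ t₀ → ∀ (x₀ : Hist n r) (d : ℝ → Euc l) (x : C(ℝ, Euc n)), V t₀ x₀ ≤ B →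
      (∀ T, t₀ ≤ T → Good f V q ρ d t₀ T x₀ x) → ∀ t, t₀ + T₁ + τ ≤ t → V t (win r x t) ≤ e := by
  have hQ0 := q_int_nonneg h.kq
  set Q := ∫ τ in Ici (0:ℝ), q τ with hQ
  obtain ⟨m, hm, hmin⟩ := (isCompact_Icc (a := e / 2) (b := max (B + Q) (e / 2))).exists_isMinOn
    ⟨e / 2, le_rfl, le_max_right _ _⟩ (h.kρ.1.mono (fun t ht => (by linarith [ht.1] : (0:ℝ) ≤ t)))
  have hc : 0 < ρ m := h.kρ.2.2.1 m (by linarith [hm.1])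
  refine ⟨(B + Q + Q) / ρ m, by positivity, ?_⟩
  intro t₀ ht₀ x₀ d x hV hx t ht
  set τ := (B + Q + Q) / ρ m with hτ
  have hτ0 : 0 ≤ τ := by rw [hτ]; positivity
  have hVB : ∀ s, t₀ ≤ s → V s (win r x s) ≤ B + Q := fun s hs => by
    have := good_bound h ht₀ (hx s hs) ⟨hs, le_rfl⟩
    linarith
  have hex : ∃ s ∈ Icc (t₀ + T₁) (t₀ + T₁ + τ), V s (win r x s) ≤ e / 2 := by
    by_contra hcon
    push Not at hcon
    have hst : t₀ + T₁ ≤ t₀ + T₁ + τ := by linarith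
    have h0s : 0 ≤ t₀ + T₁ := by linarith
    have h1 := (hx (t₀ + T₁ + τ) (by linarith)).2.2 (t₀ + T₁) _ (by linarith) hst le_rfl
    have h2 := q_le h.kq le_rfl h0s hst
    have h3 : ∫ σ in (t₀ + T₁)..(t₀ + T₁ + τ), ρ m ≤
        ∫ σ in (t₀ + T₁)..(t₀ + T₁ + τ), ρ (V σ (win r x σ)) := by
      apply intervalIntegral.integral_mono_on hst intervalIntegrable_const (ρV_intble h x h0s hst)
      intro σ hσ
      exact hmin ⟨(hcon σ hσ).le, (hVB σ (by linarith [hσ.1])).trans (le_max_left _ _)⟩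
    rw [intervalIntegral.integral_const, smul_eq_mul, add_sub_cancel_left, hτ,
      div_mul_cancel₀ _ hc.ne'] at h3
    have h4 := hVB (t₀ + T₁) (by linarith)
    have h5 := hcon (t₀ + T₁ + τ) ⟨hst, le_rfl⟩
    rw [← hτ] at h3
    linarith
  obtain ⟨s, hs, hsV⟩ := hex
  have h1 := (hx t (by linarith)).2.2.le h ht₀ (s := s) (t := t) (by linarith [hs.1])
    (hs.2.trans ht) le_rfl
  have h2 := q_le h.kq hT₁ (s := s) (t := t) (by linarith [hs.1]) (hs.2.trans ht)
  linarith

lemma sol_spec (h : SysHyp r D f V a₁ a₂ β μ q ρ) {d : ℝ → Euc l} (hd : InMD D d)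
    {t₀ : ℝ} (ht₀ : 0 ≤ t₀) (x₀ : Hist n r) (x : C(ℝ, Euc n))
    (hx : ∀ T, t₀ ≤ T → Good f V q ρ d t₀ T x₀ x) :
    IsSolutionRFDE f d t₀ x₀ ⊤ x (win r x) ∧
      ∀ tm y ψ, IsSolutionRFDE f d t₀ x₀ tm y ψ → tm ≤ ⊤ ∧
        ∀ t : ℝ, t₀ ≤ t → (t : EReal) < tm → ψ t = win r x t := by
  have hr := h.hr
  refine ⟨⟨EReal.coe_lt_top _, (hx t₀ le_rfl).1, fun t _ _ θ => rfl, x.continuous.continuousOn,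
    fun t ht _ => (hx t ht).2.1 t ⟨ht, le_rfl⟩⟩, ?_⟩
  intro tm y ψ ⟨_, h2, h3, h4, h5⟩
  refine ⟨le_top, fun t ht htm => ?_⟩
  have hle : t₀ - r ≤ t := by linarith
  have hsub : Icc (t₀ - r) t ⊆ {s : ℝ | t₀ - r ≤ s ∧ (s : EReal) < tm} := fun s hs =>
    ⟨hs.1, lt_of_le_of_lt (EReal.coe_le_coe_iff.2 hs.2) htm⟩
  have hyc : Continuous ((Icc (t₀ - r) t).domRestrict y) :=
    continuousOn_iff_continuous_domRestrict.1 (h4.mono hsub)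
  let y' : C(ℝ, Euc n) := ⟨IccExtend hle ((Icc (t₀ - r) t).domRestrict y), hyc.Icc_extend'⟩
  have hy' : ∀ s ∈ Icc (t₀ - r) t, y' s = y s := fun s hs => by
    show IccExtend hle ((Icc (t₀ - r) t).domRestrict y) s = y s
    rw [IccExtend_of_mem _ _ hs, domRestrict_apply]
  have hψ : ∀ s ∈ Icc t₀ t, ψ s = win r y' s := by
    intro s hs
    ext1 θ
    rw [h3 s hs.1 (hsub ⟨by linarith [hs.1], hs.2⟩).2 θ, win_apply, hy']
    exact ⟨by linarith [hs.1, θ.2.1], by linarith [hs.2, θ.2.2]⟩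
  have hys : ∀ s ∈ Icc t₀ t, y' s = y' t₀ + ∫ σ in t₀..s, f σ (d σ) (win r y' σ) := by
    intro s hs
    rw [hy' s ⟨by linarith [hs.1], hs.2⟩, hy' t₀ ⟨by linarith, ht⟩,
      h5 s hs.1 (hsub ⟨by linarith [hs.1], hs.2⟩).2]
    congr 1
    apply intervalIntegral.integral_congr
    intro σ hσ
    rw [uIcc_of_le hs.1] at hσ
    simp only
    rw [hψ σ ⟨hσ.1, hσ.2.trans hs.2⟩]
  rw [hψ t ⟨ht, le_rfl⟩]
  refine sol_unique h hd ht₀ ht y' x hys (hx t ht).2.1 ?_ t ⟨ht, le_rfl⟩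
  rw [← hψ t₀ ⟨le_rfl, ht⟩, h2, (hx t ht).1]

lemma rfc_spec (h : SysHyp r D f V a₁ a₂ β μ q ρ) {T s : ℝ} (hT : 0 ≤ T) (hs : 0 ≤ s) :
    ∃ M, 0 ≤ M ∧ ∀ t₀ ∈ Icc (0:ℝ) T, ∀ ξ ∈ Icc (0:ℝ) T, ∀ x₀ : Hist n r, ‖x₀‖ ≤ s →
      ∀ (d : ℝ → Euc l) (x : C(ℝ, Euc n)), (∀ T, t₀ ≤ T → Good f V q ρ d t₀ T x₀ x) →
      ‖win r x (t₀ + ξ)‖ ≤ M := by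
  obtain ⟨R, hR0, -, hR⟩ := state_bound h (by linarith : 0 ≤ T + T) hs
  refine ⟨R, hR0, fun t₀ ht₀ ξ hξ x₀ hx₀ d x hx => ?_⟩
  exact hR _ ⟨by linarith [ht₀.1, hξ.1], by linarith [ht₀.2, hξ.2]⟩ t₀
    ⟨ht₀.1, by linarith [ht₀.2]⟩ x₀ hx₀ _
    (good_bound h ht₀.1 (hx (t₀ + ξ) (by linarith [hξ.1])) ⟨by linarith [hξ.1], le_rfl⟩)

/-- closeness to the zero solution on finite horizons -/
lemma small_state (h : SysHyp r D f V a₁ a₂ β μ q ρ)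
    (hf0 : ∀ t : ℝ, 0 ≤ t → ∀ d ∈ D, f t d 0 = 0) {T : ℝ} (hT : 0 ≤ T) :
    ∃ C R, 0 < C ∧ 0 ≤ R ∧ ∀ t₀ ∈ Icc (0:ℝ) T, ∀ x₀ : Hist n r, ‖x₀‖ ≤ 1 →
      ∀ d : ℝ → Euc l, InMD D d → ∀ x : C(ℝ, Euc n), (∀ T, t₀ ≤ T → Good f V q ρ d t₀ T x₀ x) →
      ∀ t ∈ Icc t₀ T, ‖win r x t‖ ≤ R ∧ ‖win r x t‖ ≤ C * ‖x₀‖ := by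
  obtain ⟨R, hR0, -, hR⟩ := state_bound h hT zero_le_one
  obtain ⟨M, hM0, hM⟩ := h.bdd T hT R hR0
  obtain ⟨L, hL0, hL⟩ := h.one T hT R hR0
  refine ⟨Real.exp (L * T), R, Real.exp_pos _, hR0, ?_⟩
  intro t₀ ht₀ x₀ hx₀ d hd x hx t ht
  have hb : ∀ s ∈ Icc t₀ T, ‖win r x s‖ ≤ R := fun s hs =>
    hR s ⟨ht₀.1.trans hs.1, hs.2⟩ t₀ ht₀ x₀ hx₀ _ (good_bound h ht₀.1 (hx T ht₀.2) hs)
  refine ⟨hb t ht, ?_⟩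
  have hw0 : ∀ s, win r (0 : C(ℝ, Euc n)) s = 0 := fun s => by ext1 θ; rfl
  have h1 := cont_dep h.hr h.h0 h.reg hd ht₀.1 ht₀.2 hM0 hL0
    (fun s hs => hM s ⟨ht₀.1.trans hs.1, hs.2⟩) (fun s hs => hL s ⟨ht₀.1.trans hs.1, hs.2⟩)
    x 0 hb (fun s _ => by rw [hw0, norm_zero]; exact hR0) (hx T ht₀.2).2.1
    (fun s hs => by
      have : ∫ σ in t₀..s, f σ (d σ) (win r (0 : C(ℝ, Euc n)) σ) = ∫ σ in t₀..s, (0 : Euc n) := by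
        apply intervalIntegral.integral_congr
        intro σ hσ
        rw [uIcc_of_le hs.1] at hσ
        simp only
        rw [hw0, hf0 σ (ht₀.1.trans hσ.1) _ (hd.2 σ)]
      rw [this]
      simp) t ht
  rw [hw0, hw0, sub_zero, sub_zero, (hx T ht₀.2).1, mul_comm] at h1
  refine h1.trans (mul_le_mul_of_nonneg_right ?_ (norm_nonneg _))
  apply Real.exp_le_exp.2
  apply mul_le_mul_of_nonneg_left _ hL0
  linarith [ht₀.1]

lemma kinf_le {a : ℝ → ℝ} (ha : IsKinf a) {s t : ℝ} (hs : 0 ≤ s) (ht : 0 ≤ t) (h : a s ≤ a t) :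
    s ≤ t := (ha.2.1.le_iff_le (mem_Ici.2 hs) (mem_Ici.2 ht)).1 h

lemma kinf_pos {a : ℝ → ℝ} (ha : IsKinf a) {s : ℝ} (hs : 0 < s) : 0 < a s := by
  have := ha.2.1 (mem_Ici.2 le_rfl) (mem_Ici.2 hs.le) hs
  rwa [ha.2.2.1] at this

lemma kinf_bd {a : ℝ → ℝ} (ha : IsKinf a) (B : ℝ) : ∃ M, 0 ≤ M ∧ B ≤ a M := by
  obtain ⟨M, h1, h2⟩ := ((ha.2.2.2.eventually_ge_atTop B).and (eventually_ge_atTop 0)).exists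
  exact ⟨M, h2, h1⟩

lemma kinf_small {a : ℝ → ℝ} (ha : IsKinf a) {e : ℝ} (he : 0 < e) : ∃ δ, 0 < δ ∧ a δ ≤ e := by
  have h1 : Tendsto a (𝓝[>] 0) (𝓝 0) := by
    have := (ha.1 0 (mem_Ici.2 le_rfl)).tendsto
    rw [ha.2.2.1] at this
    exact this.mono_left (nhdsWithin_mono _ Ioi_subset_Ici_self)
  obtain ⟨δ, h2, h3⟩ := ((h1.eventually_le_const he).and self_mem_nhdsWithin).exists
  exact ⟨δ, h3, h2⟩
end

/-- Proposition 4.6: Lyapunov-like sufficient conditions for RGAOS and URGAOS of the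
RFDE system (4.3) under hypotheses (Q1)-(Q5). -/
theorem stmt12 {n l : ℕ} {Y : Type*} [NormedAddCommGroup Y] [NormedSpace ℝ Y]
    (r : ℝ) (hr : 0 < r)
    (D : Set (Euc l)) (hD : IsCompact D) (hDne : D.Nonempty)
    (f : ℝ → Euc l → Hist n r → Euc n) (H : ℝ → Hist n r → Y)
    (hf0 : ∀ t : ℝ, 0 ≤ t → ∀ d ∈ D, f t d 0 = 0)
    (hH0 : ∀ t : ℝ, 0 ≤ t → H t 0 = 0)
    -- (Q1)
    (hQ1a : ∀ t : ℝ, 0 ≤ t →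
      ContinuousOn (fun p : Hist n r × Euc l => f t p.2 p.1) (univ ×ˢ D))
    (hQ1b : ∀ T, 0 ≤ T → ∀ R, 0 ≤ R → ∃ L, ∀ t ∈ Icc (0:ℝ) T, ∀ d ∈ D,
      ∀ x y : Hist n r, ‖x‖ ≤ R → ‖y‖ ≤ R →
        ⟪x ⟨0, ⟨by linarith, le_rfl⟩⟩ - y ⟨0, ⟨by linarith, le_rfl⟩⟩,
          f t d x - f t d y⟫ ≤ L * ‖x - y‖ ^ 2)
    -- (Q2)
    (hQ2 : ∀ T, 0 ≤ T → ∀ R, 0 ≤ R → ∃ M, ∀ t ∈ Icc (0:ℝ) T, ∀ d ∈ D,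
      ∀ x : Hist n r, ‖x‖ ≤ R → ‖f t d x‖ ≤ M)
    -- (Q3)
    (hQ3 : ∃ A : Set ℝ, A.Countable ∧ (∀ K : Set ℝ, IsCompact K → (A ∩ K).Finite) ∧
      ContinuousOn (fun p : ℝ × Hist n r × Euc l => f p.1 p.2.2 p.2.1)
        ((Ici 0 \ A) ×ˢ univ ×ˢ D) ∧
      ∀ t₀ : ℝ, 0 ≤ t₀ → ∀ x : Hist n r, ∀ d ∈ D,
        Tendsto (fun t => f t d x) (𝓝[>] t₀) (𝓝 (f t₀ d x)))
    -- (Q4)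
    (hQ4 : ∀ ε, 0 < ε → ∀ t : ℝ, 0 ≤ t → ∃ δ, 0 < δ ∧ ∀ τ : ℝ, 0 ≤ τ → ∀ d ∈ D,
      ∀ x : Hist n r, |τ - t| + ‖x‖ < δ → ‖f τ d x‖ < ε)
    -- (Q5): H is Lipschitz on bounded sets
    (hQ5 : ∀ T, 0 ≤ T → ∀ R, 0 ≤ R → ∃ LH, 0 ≤ LH ∧ ∀ t ∈ Icc (0:ℝ) T,
      ∀ τ ∈ Icc (0:ℝ) T, ∀ x y : Hist n r, ‖x‖ ≤ R → ‖y‖ ≤ R →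
        ‖H t x - H τ y‖ ≤ LH * (|t - τ| + ‖x - y‖))
    -- the Lyapunov functional
    (V : ℝ → Hist n r → ℝ) (hVpos : ∀ t x, 0 ≤ V t x)
    (hAL : AlmostLipschitzOn r V)
    (a₁ a₂ β μ q ρ : ℝ → ℝ)
    (ha₁ : IsKinf a₁) (ha₂ : IsKinf a₂) (hβ : IsKplus β) (hμ : IsKplus μ)
    (hq : IsClassE q) (hρ : IsPosDef ρ)
    (hVbounds : ∀ t : ℝ, 0 ≤ t → ∀ x : Hist n r,
      max (a₁ ‖H t x‖) (a₁ (μ t * ‖x‖)) ≤ V t x ∧ V t x ≤ a₂ (β t * ‖x‖))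
    (hVdecr : ∀ t : ℝ, 0 ≤ t → ∀ x : Hist n r, ∀ d ∈ D,
      diniH V t x (f t d x) ≤ ((-ρ (V t x) + q t : ℝ) : EReal)) :
    RGAOSrfde r D f H ∧
    (((∀ t, β t = 1) ∧ (∀ t, q t = 0)) → URGAOSrfde r D f H) := by
  have h : SysHyp r D f V a₁ a₂ β μ q ρ := by
    obtain ⟨A, hA, -, hc, -⟩ := hQ3
    refine ⟨hr, ⟨by linarith, le_rfl⟩, regF_of_Q hD hQ1a hA hc, ?_, ?_, hVpos, hAL, ha₁, ha₂, hβ, hμ,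
      hq, hρ, fun t ht x => (le_max_right _ _).trans (hVbounds t ht x).1,
      fun t ht x => (hVbounds t ht x).2, hVdecr⟩
    · intro T hT R hR
      obtain ⟨L, hL⟩ := hQ1b T hT R hR
      refine ⟨|L|, abs_nonneg _, fun t ht d hd x y hx hy => (hL t ht d hd x y hx hy).trans ?_⟩
      exact mul_le_mul_of_nonneg_right (le_abs_self _) (by positivity)
    · intro T hT R hR
      obtain ⟨M, hM⟩ := hQ2 T hT R hR
      exact ⟨|M|, abs_nonneg _, fun t ht d hd x hx => (hM t ht d hd x hx).trans (le_abs_self _)⟩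
  have hVH : ∀ t : ℝ, 0 ≤ t → ∀ x : Hist n r, a₁ ‖H t x‖ ≤ V t x := fun t ht x =>
    (le_max_left _ _).trans (hVbounds t ht x).1
  have hHle : ∀ t : ℝ, 0 ≤ t → ∀ (x : Hist n r) (M : ℝ), 0 ≤ M → V t x ≤ a₁ M → ‖H t x‖ ≤ M :=
    fun t ht x M hM hV => kinf_le ha₁ (norm_nonneg _) hM ((hVH t ht x).trans hV)
  have hex : ∀ (t₀ : ℝ) (x₀ : Hist n r) (d : ℝ → Euc l), ∃ x : C(ℝ, Euc n), 0 ≤ t₀ → InMD D d →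
      ∀ T, t₀ ≤ T → Good f V q ρ d t₀ T x₀ x := by
    intro t₀ x₀ d
    by_cases h1 : 0 ≤ t₀ ∧ InMD D d
    · obtain ⟨x, hx⟩ := exists_global h h1.2 h1.1 x₀
      exact ⟨x, fun _ _ => hx⟩
    · exact ⟨0, fun h2 h3 => absurd ⟨h2, h3⟩ h1⟩
  choose X hX using hex
  have hQ0 := q_int_nonneg hq
  have hspec : ∀ t₀ : ℝ, 0 ≤ t₀ → ∀ x₀ d, InMD D d →
      IsSolutionRFDE f d t₀ x₀ ⊤ (X t₀ x₀ d) (win r (X t₀ x₀ d)) ∧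
      ∀ tm y ψ, IsSolutionRFDE f d t₀ x₀ tm y ψ → tm ≤ ⊤ ∧
        ∀ t : ℝ, t₀ ≤ t → (t : EReal) < tm → ψ t = win r (X t₀ x₀ d) t := fun t₀ ht₀ x₀ d hd =>
    sol_spec h hd ht₀ x₀ _ (hX t₀ x₀ d ht₀ hd)
  have hrfc : ∀ T, 0 ≤ T → ∀ s, 0 ≤ s → ∃ M, ∀ t₀ ∈ Icc (0:ℝ) T, ∀ ξ ∈ Icc (0:ℝ) T,
      ∀ x₀ : Hist n r, ‖x₀‖ ≤ s → ∀ d, InMD D d →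
        ((t₀ + ξ : ℝ) : EReal) < ⊤ ∧ ‖win r (X t₀ x₀ d) (t₀ + ξ)‖ ≤ M := by
    intro T hT s hs
    obtain ⟨M, -, hM⟩ := rfc_spec h hT hs
    exact ⟨M, fun t₀ ht₀ ξ hξ x₀ hx₀ d hd => ⟨EReal.coe_lt_top _,
      hM t₀ ht₀ ξ hξ x₀ hx₀ d _ (hX t₀ x₀ d ht₀.1 hd)⟩⟩
  have hVle : ∀ t₀ : ℝ, 0 ≤ t₀ → ∀ x₀ d, InMD D d → ∀ t, t₀ ≤ t →
      V t (win r (X t₀ x₀ d) t) ≤ V t₀ x₀ + ∫ τ in Ici (0:ℝ), q τ := fun t₀ ht₀ x₀ d hd t ht =>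
    good_bound h ht₀ (hX t₀ x₀ d ht₀ hd t ht) ⟨ht, le_rfl⟩
  constructor
  · have hP2 : ∀ ε, 0 < ε → ∀ T, 0 ≤ T → ∀ R, 0 ≤ R → ∃ τ, 0 ≤ τ ∧
      ∀ t₀ ∈ Icc (0:ℝ) T, ∀ x₀ : Hist n r, ‖x₀‖ ≤ R → ∀ d, InMD D d →
        ∀ t : ℝ, t₀ + τ ≤ t → ‖H t (win r (X t₀ x₀ d) t)‖ ≤ ε := by
      intro ε hε T hT R hR
      have he := kinf_pos ha₁ hε
      obtain ⟨T₁, hT₁, htail⟩ := q_tail hq (half_pos he)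
      obtain ⟨B, hB0, hB⟩ := V_init h hT hR
      obtain ⟨τ, hτ, hdec⟩ := decay h he hB0 hT₁ htail
      refine ⟨T₁ + τ, by linarith, fun t₀ ht₀ x₀ hx₀ d hd t ht => ?_⟩
      exact hHle t (by linarith [ht₀.1]) _ ε hε.le (hdec t₀ ht₀.1 x₀ d _ (hB t₀ ht₀ x₀ hx₀)
        (hX t₀ x₀ d ht₀.1 hd) t (by linarith))
    refine ⟨fun t₀ x₀ d => X t₀ x₀ d, fun t₀ x₀ d => win r (X t₀ x₀ d), fun _ _ _ => ⊤, hspec, hrfc,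
      ?_, ?_⟩
    · intro ε hε T hT
      constructor
      · obtain ⟨B, hB0, hB⟩ := V_init h hT hε.le
        obtain ⟨M, hM0, hM⟩ := kinf_bd ha₁ (B + ∫ τ in Ici (0:ℝ), q τ)
        refine ⟨M, fun t₀ ht₀ x₀ hx₀ d hd t ht _ => ?_⟩
        refine hHle t (ht₀.1.trans ht) _ M hM0 ?_
        linarith [hVle t₀ ht₀.1 x₀ d hd t ht, hB t₀ ht₀ x₀ hx₀]
      · obtain ⟨τ, hτ, hP⟩ := hP2 ε hε T hT 1 zero_le_one
        have hTτ : 0 ≤ T + τ := by linarith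
        obtain ⟨C, R, hC, hR, hs⟩ := small_state h hf0 hTτ
        obtain ⟨LH, hLH, hH⟩ := hQ5 (T + τ) hTτ R hR
        have hden : 0 < LH * C + 1 := by positivity
        refine ⟨min 1 (ε / (LH * C + 1)), lt_min one_pos (by positivity), ?_⟩
        intro t₀ ht₀ x₀ hx₀ d hd t ht _
        have hx1 : ‖x₀‖ ≤ 1 := hx₀.trans (min_le_left _ _)
        have hx2 : ‖x₀‖ * (LH * C + 1) ≤ ε :=
          (le_div_iff₀ hden).1 (hx₀.trans (min_le_right _ _))
        rcases le_total (t₀ + τ) t with h1 | h1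
        · exact hP t₀ ht₀ x₀ hx1 d hd t h1
        · have htT : t ≤ T + τ := by linarith [ht₀.2]
          obtain ⟨h2, h3⟩ := hs t₀ ⟨ht₀.1, by linarith [ht₀.2]⟩ x₀ hx1 d hd _
            (hX t₀ x₀ d ht₀.1 hd) t ⟨ht, htT⟩
          have ht' : t ∈ Icc (0:ℝ) (T + τ) := ⟨ht₀.1.trans ht, htT⟩
          have h4 := hH t ht' t ht' _ 0 h2 (by rw [norm_zero]; exact hR)
          rw [hH0 t ht'.1, sub_zero, sub_zero, sub_self, abs_zero, zero_add] at h4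
          have h5 := mul_le_mul_of_nonneg_left h3 hLH
          have h6 := norm_nonneg x₀
          show ‖H t (win r (X t₀ x₀ d) t)‖ ≤ ε
          nlinarith
    · intro ε hε T hT R hR
      obtain ⟨τ, hτ, hP⟩ := hP2 ε hε T hT R hR
      exact ⟨τ, hτ, fun t₀ ht₀ x₀ hx₀ d hd t ht _ => hP t₀ ht₀ x₀ hx₀ d hd t ht⟩
  · rintro ⟨hβ1, hq0⟩
    have hQz : ∫ τ in Ici (0:ℝ), q τ = 0 := by simp [hq0]
    have hV0 : ∀ t₀ : ℝ, 0 ≤ t₀ → ∀ x₀ : Hist n r, ∀ s, ‖x₀‖ ≤ s → V t₀ x₀ ≤ a₂ s := by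
      intro t₀ ht₀ x₀ s hs
      have := (hVbounds t₀ ht₀ x₀).2
      rw [hβ1, one_mul] at this
      exact this.trans (ha₂.2.1.monotoneOn (mem_Ici.2 (norm_nonneg _))
        (mem_Ici.2 ((norm_nonneg _).trans hs)) hs)
    refine ⟨fun t₀ x₀ d => X t₀ x₀ d, fun t₀ x₀ d => win r (X t₀ x₀ d), fun _ _ _ => ⊤, hspec, hrfc,
      ?_, ?_⟩
    · intro ε hε
      constructor
      · obtain ⟨M, hM0, hM⟩ := kinf_bd ha₁ (a₂ ε)
        refine ⟨M, fun t₀ ht₀ x₀ hx₀ d hd t ht _ => ?_⟩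
        refine hHle t (ht₀.trans ht) _ M hM0 ?_
        linarith [hVle t₀ ht₀ x₀ d hd t ht, hV0 t₀ ht₀ x₀ ε hx₀]
      · obtain ⟨δ, hδ, hδ'⟩ := kinf_small ha₂ (kinf_pos ha₁ hε)
        refine ⟨δ, hδ, fun t₀ ht₀ x₀ hx₀ d hd t ht _ => ?_⟩
        refine hHle t (ht₀.trans ht) _ ε hε.le ?_
        linarith [hVle t₀ ht₀ x₀ d hd t ht, hV0 t₀ ht₀ x₀ δ hx₀]
    · intro ε hε R hR
      have he := kinf_pos ha₁ hε
      have hB0 : 0 ≤ a₂ R := by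
        have := ha₂.2.1.monotoneOn (mem_Ici.2 le_rfl) (mem_Ici.2 hR) hR
        rwa [ha₂.2.2.1] at this
      obtain ⟨τ, hτ, hdec⟩ := decay h he hB0 le_rfl (by rw [hQz]; linarith)
      refine ⟨τ, hτ, fun t₀ ht₀ x₀ hx₀ d hd t ht _ => ?_⟩
      exact hHle t (by linarith) _ ε hε.le (hdec t₀ ht₀ x₀ d _ (hV0 t₀ ht₀ x₀ R hx₀)
        (hX t₀ x₀ d ht₀ hd) t (by linarith))
end
end

section
/- Let V : [0,∞)×C⁰([−r,0];ℝⁿ) → [0,∞) be continuous and suppose there exists a continuous nondecreasing function L_V : [0,∞) → [0,∞) such that for every R ≥ 0: |V(t,y) − V(t,x)| ≤ L_V(R)·‖y−x‖_r for all t ∈ [0,R] and all x, y ∈ C⁰([−r,0];ℝⁿ) with ‖x‖_r ≤ R and ‖y‖_r ≤ R. Then for all t ≥ 0, x ∈ C⁰([−r,0];ℝⁿ) and v, w ∈ ℝⁿ: V⁰(t, x; v) ≤ L_V(t + ‖x‖_r)·|v − w| + V⁰(t, x; w). -/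
open Filter Topology MeasureTheory Set RealInnerProductSpace

noncomputable section

lemma Ehist_apply_aux {n : ℕ} {r : ℝ} (hr : -r ≤ 0) (h : ℝ) (x : Hist n r) (v : Euc n)
    (θ : Icc (-r) (0:ℝ)) :
    Ehist h x v θ = if (θ : ℝ) ≤ -h then x (projIcc (-r) 0 hr ((θ : ℝ) + h))
        else x (projIcc (-r) 0 hr 0) + ((θ : ℝ) + h) • v := by
  simp only [Ehist, dif_pos hr, ContinuousMap.coe_mk]

lemma Ehist_norm_aux {n : ℕ} {r : ℝ} (hr : -r ≤ 0) (h : ℝ) (hh : 0 ≤ h) (x : Hist n r)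
    (v : Euc n) : ‖Ehist h x v‖ ≤ ‖x‖ + h * ‖v‖ := by
  have h0 : 0 ≤ h * ‖v‖ := mul_nonneg hh (norm_nonneg _)
  refine (ContinuousMap.norm_le _ (add_nonneg (norm_nonneg _) h0)).2 fun θ => ?_
  rw [Ehist_apply_aux hr]
  split_ifs with hc
  · exact (x.norm_coe_le_norm _).trans (by linarith)
  · refine (norm_add_le _ _).trans (add_le_add (x.norm_coe_le_norm _) ?_)
    rw [norm_smul, Real.norm_eq_abs, abs_of_nonneg (by linarith)]
    exact mul_le_mul_of_nonneg_right (by linarith [θ.2.2]) (norm_nonneg _)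

lemma Ehist_sub_aux {n : ℕ} {r : ℝ} (hr : -r ≤ 0) (h : ℝ) (hh : 0 ≤ h) (x : Hist n r)
    (v w : Euc n) : ‖Ehist h x v - Ehist h x w‖ ≤ h * ‖v - w‖ := by
  have h0 : 0 ≤ h * ‖v - w‖ := mul_nonneg hh (norm_nonneg _)
  refine (ContinuousMap.norm_le _ h0).2 fun θ => ?_
  rw [ContinuousMap.sub_apply, Ehist_apply_aux hr, Ehist_apply_aux hr]
  split_ifs with hc
  · simpa using h0
  · rw [add_sub_add_left_eq_sub, ← smul_sub, norm_smul, Real.norm_eq_abs,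
      abs_of_nonneg (by linarith)]
    exact mul_le_mul_of_nonneg_right (by linarith [θ.2.2]) (norm_nonneg _)

/-- Inequality (4.30): if V is completely Lipschitz on bounded sets with modulus L_V,
then V⁰(t,x;v) ≤ L_V(t+‖x‖_r)·|v−w| + V⁰(t,x;w). -/
theorem stmt18 {n : ℕ} (r : ℝ) (hr : 0 < r) (V : ℝ → Hist n r → ℝ)
    (hVc : ContinuousOn (fun p : ℝ × Hist n r => V p.1 p.2) (Ici 0 ×ˢ univ))
    (LV : ℝ → ℝ) (hLVmono : Monotone LV) (hLVcont : Continuous LV)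
    (hLVpos : ∀ s, 0 ≤ s → 0 ≤ LV s)
    (hlip : ∀ R, 0 ≤ R → ∀ t ∈ Icc (0:ℝ) R, ∀ x y : Hist n r, ‖x‖ ≤ R → ‖y‖ ≤ R →
      |V t y - V t x| ≤ LV R * ‖y - x‖) :
    ∀ t : ℝ, 0 ≤ t → ∀ (x : Hist n r) (v w : Euc n),
      diniH V t x v ≤ ((LV (t + ‖x‖) * ‖v - w‖ : ℝ) : EReal) + diniH V t x w := by
  intro t ht x v w
  have hr0 : -r ≤ 0 := by linarith
  set R : ℝ → ℝ := fun h => t + ‖x‖ + h * (2 + ‖v‖ + ‖w‖) with hR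
  set u : ℝ × Hist n r → EReal := fun p => ((LV (R p.1) * ‖v - w‖ : ℝ) : EReal) with hu
  have hlim : Tendsto u ((𝓝[>] (0:ℝ)) ×ˢ 𝓝 0)
      (𝓝 ((LV (t + ‖x‖) * ‖v - w‖ : ℝ) : EReal)) := by
    have hc : Continuous (fun h : ℝ => ((LV (R h) * ‖v - w‖ : ℝ) : EReal)) :=
      continuous_coe_real_ereal.comp
        ((hLVcont.comp (by rw [hR]; fun_prop)).mul continuous_const)
    have h1 := (hc.tendsto 0).mono_left (nhdsWithin_le_nhds (s := Ioi 0))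
    have h2 : R 0 = t + ‖x‖ := by simp [hR]
    rw [h2] at h1
    exact h1.comp tendsto_fst
  have hls : limsup u ((𝓝[>] (0:ℝ)) ×ˢ 𝓝 (0 : Hist n r))
      = ((LV (t + ‖x‖) * ‖v - w‖ : ℝ) : EReal) := hlim.limsup_eq
  unfold diniH
  rw [← hls]
  refine le_trans ?_ (EReal.limsup_add_le (Or.inl ?_) (Or.inl ?_))
  · refine limsup_le_limsup ?_
    have e1 : ∀ᶠ h in 𝓝[>] (0:ℝ), 0 < h := self_mem_nhdsWithin
    have e2 : ∀ᶠ y in 𝓝 (0 : Hist n r), ‖y‖ < 1 := by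
      filter_upwards [Metric.ball_mem_nhds (0 : Hist n r) one_pos] with y hy
      simpa using hy
    filter_upwards [e1.prod_mk e2] with p hp
    obtain ⟨h, y⟩ := p
    obtain ⟨hh, hy⟩ := hp
    simp only at hh hy
    simp only [Pi.add_apply, hu]
    rw [← EReal.coe_add, EReal.coe_le_coe_iff]
    have n1 := norm_nonneg v
    have n2 := norm_nonneg w
    have n3 := norm_nonneg x
    have m1 := mul_nonneg hh.le n1
    have m2 := mul_nonneg hh.le n2
    have hRe : R h = t + ‖x‖ + h * 2 + h * ‖v‖ + h * ‖w‖ := by simp only [hR]; ring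
    have hyn : ‖h • y‖ ≤ h := by
      rw [norm_smul, Real.norm_eq_abs, abs_of_pos hh]
      nlinarith
    have a1 : ‖Ehist h x v + h • y‖ ≤ R h := by
      have := norm_add_le (Ehist h x v) (h • y)
      have := Ehist_norm_aux hr0 h hh.le x v
      linarith
    have a2 : ‖Ehist h x w + h • y‖ ≤ R h := by
      have := norm_add_le (Ehist h x w) (h • y)
      have := Ehist_norm_aux hr0 h hh.le x w
      linarith
    have hR0 : 0 ≤ R h := by linarith
    have key := hlip (R h) hR0 (t + h) ⟨by linarith, by linarith⟩ _ _ a2 a1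
    rw [add_sub_add_right_eq_sub] at key
    have k2 := mul_le_mul_of_nonneg_left (Ehist_sub_aux hr0 h hh.le x v w) (hLVpos _ hR0)
    have k3 := (le_abs_self _).trans (key.trans k2)
    rw [← sub_le_iff_le_add, ← sub_div, div_le_iff₀ hh]
    linarith
  · rw [hls]; exact EReal.coe_ne_bot _
  · rw [hls]; exact EReal.coe_ne_top _
end
end
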